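/- ¬p-p-¬p Lemma: let ¬x₁, x₂, ¬x₃ be occurrences of ¬p, p, ¬p respectively in a formula A of L∧,∨^{¬p}, and ¬y₁, y₂, ¬y₃ occurrences of ¬p, p, ¬p respectively in a formula B of L∧,∨^{¬p}. Let g₁ : A′ ⊢ A be a Ξ̂∧_{p,C}-term of PN whose head's crown is x₂ ∨ ¬x₃ or ¬x₃ ∨ x₂, let g₂ : B ⊢ B′ be a Θ̂∨_{p,D}-term of PN whose head's crown is ¬y₁ ∧ y₂ or y₂ ∧ ¬y₁, and let f : A ⊢ B be an arrow term of DS^{¬p} such that x_i and y_i are linked in f for i ∈ {1,2,3}. Then g₂ ∘ f ∘ g₁ is equal in PN to an arrow term of DS^{¬p}. -/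

import Mathlib

/-! ### The category Br of Brauerian split equivalences of finite ordinals

An arrow `m ⊢ n` of `Br` is represented as a relation on `ℕ ⊕ ℕ`, where
`Sum.inl i` (with `i < m`) is the source copy `i_s` and `Sum.inr j`
(with `j < n`) is the target copy `j_t`. -/

abbrev GRel : Type := (ℕ ⊕ ℕ) → (ℕ ⊕ ℕ) → Prop

/-- The identity arrow of `Br` on `n`: transversals `{i_s, i_t}` for `i < n`. -/
def gId (n : ℕ) : GRel := fun u v =>
  ∃ i, i < n ∧ (u = Sum.inl i ∨ u = Sum.inr i) ∧ (v = Sum.inl i ∨ v = Sum.inr i)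

/-- The Brauerian split equivalence whose transversals are `{i_s, (φ i)_t}` for `i < m`. -/
def gFun (m : ℕ) (φ : ℕ → ℕ) : GRel := fun u v =>
  ∃ i, i < m ∧ (u = Sum.inl i ∨ u = Sum.inr (φ i)) ∧ (v = Sum.inl i ∨ v = Sum.inr (φ i))

/-- The block transposition exchanging the first `a` and the last `b` elements. -/
def gSwap (a b : ℕ) : GRel :=
  gFun (a + b) (fun i => if i < a then i + b else i - a)

/-- `G Δ̂∧_{B,A}` with `a = GA`, `b = GB`: identity transversals on the stem `A`
together with caps joining the two copies of each letter occurrence of `B` in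
the crown `¬B ∨ B` of the target. -/
def gDelta (a b : ℕ) : GRel := fun u v =>
  (∃ i, i < a ∧ (u = Sum.inl i ∨ u = Sum.inr i) ∧ (v = Sum.inl i ∨ v = Sum.inr i)) ∨
  (∃ j, j < b ∧ (u = Sum.inr (a + j) ∨ u = Sum.inr (a + b + j)) ∧
                (v = Sum.inr (a + j) ∨ v = Sum.inr (a + b + j)))

/-- `G Σ̂∨_{B,A}` with `a = GA`, `b = GB`: identity transversals on the stem `A`
together with cups joining the two copies of each letter occurrence of `B` in
the crown `B ∧ ¬B` of the source. -/
def gSigma (a b : ℕ) : GRel := fun u v =>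
  (∃ i, i < a ∧ (u = Sum.inl (2*b + i) ∨ u = Sum.inr i) ∧
                (v = Sum.inl (2*b + i) ∨ v = Sum.inr i)) ∨
  (∃ j, j < b ∧ (u = Sum.inl j ∨ u = Sum.inl (b + j)) ∧
                (v = Sum.inl j ∨ v = Sum.inl (b + j)))

/-- Composition `P ∗ R` in `Br`: glue along the middle copy and take the
transitive closure, restricted to the outer copies. -/
def gComp (Pr R : GRel) : GRel := fun u v =>
  Relation.TransGen
    (fun x y : ℕ ⊕ ℕ ⊕ ℕ =>
      (∃ x' y', Sum.map id Sum.inl x' = x ∧ Sum.map id Sum.inl y' = y ∧ R x' y') ∨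
      (∃ x' y', Sum.inr x' = x ∧ Sum.inr y' = y ∧ Pr x' y'))
    (Sum.map id Sum.inr u) (Sum.map id Sum.inr v)

/-- Shift a split relation by `a` on the source side and by `d` on the target side. -/
def gShift (a d : ℕ) (R : GRel) : GRel := fun u v =>
  ∃ u' v', R u' v' ∧ u = Sum.map (· + a) (· + d) u' ∧ v = Sum.map (· + a) (· + d) v'

/-- Disjoint union of split relations: `G(f ξ g) = Gf ∪ Gg_{+GD}^{+GA}`. -/
def gPar (a d : ℕ) (R S : GRel) : GRel := fun u v => R u v ∨ gShift a d S u v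
/-! ### The language L∧,∨^{¬p} generated from `P ∪ P¬` (negation applied only to letters) -/

inductive Form (P : Type) : Type
  | pos : P → Form P
  | natom : P → Form P
  | conj : Form P → Form P → Form P
  | disj : Form P → Form P → Form P

infixr:70 " ⋏ " => Form.conj
infixr:66 " ⋎ " => Form.disj

/-- The number of occurrences of letters (elements of `P ∪ P¬`) in a formula. -/
def Form.size {P : Type} : Form P → ℕ
  | .pos _ => 1
  | .natom _ => 1
  | .conj A B => A.size + B.size
  | .disj A B => A.size + B.size
/-! ### Arrow terms of the category PN -/

inductive Term (P : Type) : Form P → Form P → Type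
  | id (A : Form P) : Term P A A
  | comp {A B C : Form P} : Term P B C → Term P A B → Term P A C
  | conj {A B D E : Form P} : Term P A D → Term P B E → Term P (A ⋏ B) (D ⋏ E)
  | disj {A B D E : Form P} : Term P A D → Term P B E → Term P (A ⋎ B) (D ⋎ E)
  | bConjTo (A B C : Form P) : Term P (A ⋏ (B ⋏ C)) ((A ⋏ B) ⋏ C)
  | bConjFrom (A B C : Form P) : Term P ((A ⋏ B) ⋏ C) (A ⋏ (B ⋏ C))
  | bDisjTo (A B C : Form P) : Term P (A ⋎ (B ⋎ C)) ((A ⋎ B) ⋎ C)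
  | bDisjFrom (A B C : Form P) : Term P ((A ⋎ B) ⋎ C) (A ⋎ (B ⋎ C))
  | cConj (A B : Form P) : Term P (A ⋏ B) (B ⋏ A)
  | cDisj (A B : Form P) : Term P (B ⋎ A) (A ⋎ B)
  | d (A B C : Form P) : Term P (A ⋏ (B ⋎ C)) ((A ⋏ B) ⋎ C)
  | delta (p : P) (A : Form P) : Term P A (A ⋏ (Form.natom p ⋎ Form.pos p))
  | sigma (p : P) (A : Form P) : Term P ((Form.pos p ⋏ Form.natom p) ⋎ A) A

infixr:80 " ⬝ " => Term.comp
infixr:70 " ⊼ " => Term.conj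
infixr:66 " ⊽ " => Term.disj

/-- The arrow `d^R_{C,B,A} : (C∨B)∧A ⊢ C∨(B∧A)`. -/
def dR {P : Type} (C B A : Form P) : Term P ((C ⋎ B) ⋏ A) (C ⋎ (B ⋏ A)) :=
  Term.cDisj C (B ⋏ A) ⬝ ((Term.cConj A B ⊽ Term.id C) ⬝
    (Term.d A B C ⬝ ((Term.id A ⊼ Term.cDisj B C) ⬝ Term.cConj (C ⋎ B) A)))

/-- `Σ̂∧_{p,A} = ĉ∧ ∘ Δ̂∧_{p,A} : A ⊢ (¬p∨p)∧A`. -/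
def sigmaConj {P : Type} (p : P) (A : Form P) :
    Term P A ((Form.natom p ⋎ Form.pos p) ⋏ A) :=
  Term.cConj A (Form.natom p ⋎ Form.pos p) ⬝ Term.delta p A

/-- `Δ̂∨_{p,A} = Σ̂∨_{p,A} ∘ ĉ∨ : A∨(p∧¬p) ⊢ A`. -/
def deltaDisj {P : Type} (p : P) (A : Form P) :
    Term P (A ⋎ (Form.pos p ⋏ Form.natom p)) A :=
  Term.sigma p A ⬝ Term.cDisj (Form.pos p ⋏ Form.natom p) A

/-- `Δ̂∧′_{p,A} = (1_A ∧ ĉ∨) ∘ Δ̂∧_{p,A} : A ⊢ A∧(p∨¬p)`. -/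
def delta' {P : Type} (p : P) (A : Form P) :
    Term P A (A ⋏ (Form.pos p ⋎ Form.natom p)) :=
  (Term.id A ⊼ Term.cDisj (Form.pos p) (Form.natom p)) ⬝ Term.delta p A

/-- `Σ̂∨′_{p,A} = Σ̂∨_{p,A} ∘ (ĉ∧ ∨ 1_A) : (¬p∧p)∨A ⊢ A`. -/
def sigma' {P : Type} (p : P) (A : Form P) :
    Term P ((Form.natom p ⋏ Form.pos p) ⋎ A) A :=
  Term.sigma p A ⬝ (Term.cConj (Form.natom p) (Form.pos p) ⊽ Term.id A)

/-- `Σ̂∧′_{p,A} = ĉ∧ ∘ Δ̂∧′_{p,A} : A ⊢ (p∨¬p)∧A`. -/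
def sigmaConj' {P : Type} (p : P) (A : Form P) :
    Term P A ((Form.pos p ⋎ Form.natom p) ⋏ A) :=
  Term.cConj A (Form.pos p ⋎ Form.natom p) ⬝ delta' p A

/-- `Δ̂∨′_{p,A} = Σ̂∨′_{p,A} ∘ ĉ∨ : A∨(¬p∧p) ⊢ A`. -/
def deltaDisj' {P : Type} (p : P) (A : Form P) :
    Term P (A ⋎ (Form.natom p ⋏ Form.pos p)) A :=
  sigma' p A ⬝ Term.cDisj (Form.natom p ⋏ Form.pos p) A
/-! ### The equations of DS, imposed on arrow terms -/

inductive Eqv {P : Type} : ∀ {A B : Form P}, Term P A B → Term P A B → Prop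
  -- equivalence and congruence
  | refl {A B : Form P} (f : Term P A B) : Eqv f f
  | symm {A B : Form P} {f g : Term P A B} : Eqv f g → Eqv g f
  | trans {A B : Form P} {f g h : Term P A B} : Eqv f g → Eqv g h → Eqv f h
  | congComp {A B C : Form P} {g g' : Term P B C} {f f' : Term P A B} :
      Eqv g g' → Eqv f f' → Eqv (g ⬝ f) (g' ⬝ f')
  | congConj {A B D E : Form P} {f f' : Term P A D} {g g' : Term P B E} :
      Eqv f f' → Eqv g g' → Eqv (f ⊼ g) (f' ⊼ g')
  | congDisj {A B D E : Form P} {f f' : Term P A D} {g g' : Term P B E} :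
      Eqv f f' → Eqv g g' → Eqv (f ⊽ g) (f' ⊽ g')
  -- (cat 1), (cat 2)
  | catIdR {A B : Form P} (f : Term P A B) : Eqv (f ⬝ Term.id A) f
  | catIdL {A B : Form P} (f : Term P A B) : Eqv (Term.id B ⬝ f) f
  | catAssoc {A B C D : Form P} (f : Term P A B) (g : Term P B C) (h : Term P C D) :
      Eqv (h ⬝ (g ⬝ f)) ((h ⬝ g) ⬝ f)
  -- bifunctorial equations (ξ 1), (ξ 2)
  | conjOne (A B : Form P) : Eqv (Term.id A ⊼ Term.id B) (Term.id (A ⋏ B))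
  | disjOne (A B : Form P) : Eqv (Term.id A ⊽ Term.id B) (Term.id (A ⋎ B))
  | conjTwo {A₁ B₁ C₁ A₂ B₂ C₂ : Form P} (g₁ : Term P B₁ C₁) (f₁ : Term P A₁ B₁)
      (g₂ : Term P B₂ C₂) (f₂ : Term P A₂ B₂) :
      Eqv ((g₁ ⬝ f₁) ⊼ (g₂ ⬝ f₂)) ((g₁ ⊼ g₂) ⬝ (f₁ ⊼ f₂))
  | disjTwo {A₁ B₁ C₁ A₂ B₂ C₂ : Form P} (g₁ : Term P B₁ C₁) (f₁ : Term P A₁ B₁)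
      (g₂ : Term P B₂ C₂) (f₂ : Term P A₂ B₂) :
      Eqv ((g₁ ⬝ f₁) ⊽ (g₂ ⬝ f₂)) ((g₁ ⊽ g₂) ⬝ (f₁ ⊽ f₂))
  -- naturality equations
  | bConjNat {A B C D E F : Form P} (f : Term P A D) (g : Term P B E) (h : Term P C F) :
      Eqv (((f ⊼ g) ⊼ h) ⬝ Term.bConjTo A B C) (Term.bConjTo D E F ⬝ (f ⊼ (g ⊼ h)))
  | bDisjNat {A B C D E F : Form P} (f : Term P A D) (g : Term P B E) (h : Term P C F) :
      Eqv (((f ⊽ g) ⊽ h) ⬝ Term.bDisjTo A B C) (Term.bDisjTo D E F ⬝ (f ⊽ (g ⊽ h)))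
  | cConjNat {A B D E : Form P} (f : Term P A D) (g : Term P B E) :
      Eqv ((g ⊼ f) ⬝ Term.cConj A B) (Term.cConj D E ⬝ (f ⊼ g))
  | cDisjNat {A B D E : Form P} (f : Term P A D) (g : Term P B E) :
      Eqv ((g ⊽ f) ⬝ Term.cDisj B A) (Term.cDisj E D ⬝ (f ⊽ g))
  | dNat {A B C D E F : Form P} (f : Term P A D) (g : Term P B E) (h : Term P C F) :
      Eqv (((f ⊼ g) ⊽ h) ⬝ Term.d A B C) (Term.d D E F ⬝ (f ⊼ (g ⊽ h)))
  -- (b̂ξ b̂ξ)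
  | bConjIso₁ (A B C : Form P) :
      Eqv (Term.bConjFrom A B C ⬝ Term.bConjTo A B C) (Term.id (A ⋏ (B ⋏ C)))
  | bConjIso₂ (A B C : Form P) :
      Eqv (Term.bConjTo A B C ⬝ Term.bConjFrom A B C) (Term.id ((A ⋏ B) ⋏ C))
  | bDisjIso₁ (A B C : Form P) :
      Eqv (Term.bDisjFrom A B C ⬝ Term.bDisjTo A B C) (Term.id (A ⋎ (B ⋎ C)))
  | bDisjIso₂ (A B C : Form P) :
      Eqv (Term.bDisjTo A B C ⬝ Term.bDisjFrom A B C) (Term.id ((A ⋎ B) ⋎ C))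
  -- (b̂ξ 5)
  | bConjPent (A B C D : Form P) :
      Eqv (Term.bConjFrom A B (C ⋏ D) ⬝ Term.bConjFrom (A ⋏ B) C D)
        ((Term.id A ⊼ Term.bConjFrom B C D) ⬝
          (Term.bConjFrom A (B ⋏ C) D ⬝ (Term.bConjFrom A B C ⊼ Term.id D)))
  | bDisjPent (A B C D : Form P) :
      Eqv (Term.bDisjFrom A B (C ⋎ D) ⬝ Term.bDisjFrom (A ⋎ B) C D)
        ((Term.id A ⊽ Term.bDisjFrom B C D) ⬝
          (Term.bDisjFrom A (B ⋎ C) D ⬝ (Term.bDisjFrom A B C ⊽ Term.id D)))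
  -- (ĉ∧ ĉ∧), (ĉ∨ ĉ∨)
  | cConjIso (A B : Form P) : Eqv (Term.cConj B A ⬝ Term.cConj A B) (Term.id (A ⋏ B))
  | cDisjIso (A B : Form P) : Eqv (Term.cDisj A B ⬝ Term.cDisj B A) (Term.id (A ⋎ B))
  -- (b̂∧ ĉ∧), (b̂∨ ĉ∨)
  | bcConj (A B C : Form P) :
      Eqv ((Term.id B ⊼ Term.cConj C A) ⬝ (Term.bConjFrom B C A ⬝
            (Term.cConj A (B ⋏ C) ⬝ (Term.bConjFrom A B C ⬝ (Term.cConj B A ⊼ Term.id C)))))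
        (Term.bConjFrom B A C)
  | bcDisj (A B C : Form P) :
      Eqv ((Term.id B ⊽ Term.cDisj A C) ⬝ (Term.bDisjFrom B C A ⬝
            (Term.cDisj (B ⋎ C) A ⬝ (Term.bDisjFrom A B C ⬝ (Term.cDisj A B ⊽ Term.id C)))))
        (Term.bDisjFrom B A C)
  -- (d ∧), (d ∨)
  | dConj (A B C D : Form P) :
      Eqv ((Term.bConjFrom A B C ⊽ Term.id D) ⬝ Term.d (A ⋏ B) C D)
        (Term.d A (B ⋏ C) D ⬝ ((Term.id A ⊼ Term.d B C D) ⬝ Term.bConjFrom A B (C ⋎ D)))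
  | dDisj (D C B A : Form P) :
      Eqv (Term.d D C (B ⋎ A) ⬝ (Term.id D ⊼ Term.bDisjFrom C B A))
        (Term.bDisjFrom (D ⋏ C) B A ⬝ ((Term.d D C B ⊽ Term.id A) ⬝ Term.d D (C ⋎ B) A))
  -- (d b̂∧), (d b̂∨)
  | dBConj (A B C D : Form P) :
      Eqv (dR (A ⋏ B) C D ⬝ (Term.d A B C ⊼ Term.id D))
        (Term.d A B (C ⋏ D) ⬝ ((Term.id A ⊼ dR B C D) ⬝ Term.bConjFrom A (B ⋎ C) D))
  | dBDisj (D C B A : Form P) :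
      Eqv ((Term.id D ⊽ Term.d C B A) ⬝ dR D C (B ⋎ A))
        (Term.bDisjFrom D (C ⋏ B) A ⬝ ((dR D C B ⊽ Term.id A) ⬝ Term.d (D ⋎ C) B A))
  -- (Δ̂∧ nat)
  | deltaNat {A D : Form P} (p : P) (f : Term P A D) :
      Eqv ((f ⊼ Term.id (Form.natom p ⋎ Form.pos p)) ⬝ Term.delta p A) (Term.delta p D ⬝ f)
  -- (Σ̂∨ nat)
  | sigmaNat {A D : Form P} (p : P) (f : Term P A D) :
      Eqv (f ⬝ Term.sigma p A) (Term.sigma p D ⬝ (Term.id (Form.pos p ⋏ Form.natom p) ⊽ f))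
  -- (b̂∧ Δ̂∧)
  | bDelta (A B : Form P) (p : P) :
      Eqv (Term.bConjFrom A B (Form.natom p ⋎ Form.pos p) ⬝ Term.delta p (A ⋏ B))
        (Term.id A ⊼ Term.delta p B)
  -- (b̂∨ Σ̂∨)
  | bSigma (p : P) (B A : Form P) :
      Eqv (Term.sigma p (B ⋎ A) ⬝ Term.bDisjFrom (Form.pos p ⋏ Form.natom p) B A)
        (Term.sigma p B ⊽ Term.id A)
  -- (d Σ̂∧)
  | dSigmaConj (p : P) (B C : Form P) :
      Eqv (Term.d (Form.natom p ⋎ Form.pos p) B C ⬝ sigmaConj p (B ⋎ C))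
        (sigmaConj p B ⊽ Term.id C)
  -- (d Δ̂∨)
  | dDeltaDisj (p : P) (C B : Form P) :
      Eqv (deltaDisj p (C ⋏ B) ⬝ Term.d C B (Form.pos p ⋏ Form.natom p))
        (Term.id C ⊼ deltaDisj p B)
  -- (Σ̂∨ Δ̂∧)
  | sigmaDelta (p : P) :
      Eqv (Term.sigma p (Form.pos p) ⬝
            (Term.d (Form.pos p) (Form.natom p) (Form.pos p) ⬝ Term.delta p (Form.pos p)))
        (Term.id (Form.pos p))
  -- (Σ̂∨′ Δ̂∧′)
  | sigmaDelta' (p : P) :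
      Eqv (sigma' p (Form.natom p) ⬝
            (Term.d (Form.natom p) (Form.pos p) (Form.natom p) ⬝ delta' p (Form.natom p)))
        (Term.id (Form.natom p))
/-- The functor `G` from DS to Br on arrow terms. -/
def Term.G {P : Type} : ∀ {A B : Form P}, Term P A B → GRel
  | _, _, .id A => gId A.size
  | _, _, .comp g f => gComp (Term.G g) (Term.G f)
  | _, _, @Term.conj _ A _ D _ f g => gPar A.size D.size (Term.G f) (Term.G g)
  | _, _, @Term.disj _ A _ D _ f g => gPar A.size D.size (Term.G f) (Term.G g)
  | _, _, .bConjTo A B C => gId (A.size + (B.size + C.size))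
  | _, _, .bConjFrom A B C => gId (A.size + B.size + C.size)
  | _, _, .bDisjTo A B C => gId (A.size + (B.size + C.size))
  | _, _, .bDisjFrom A B C => gId (A.size + B.size + C.size)
  | _, _, .cConj A B => gSwap A.size B.size
  | _, _, .cDisj A B => gSwap B.size A.size
  | _, _, .d A B C => gId (A.size + (B.size + C.size))
  | _, _, .delta _ A => gDelta A.size 1
  | _, _, .sigma _ A => gSigma A.size 1
/-! ### Occurrences of letters and subformula occurrences in L∧,∨^{¬p} -/

/-- The letter (element of `P ∪ P¬`, as an atomic formula) at the `(n+1)`-th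
letter-occurrence position of a formula. -/
def Form.letterAt {P : Type} : Form P → ℕ → Option (Form P)
  | .pos p, 0 => some (.pos p)
  | .pos _, _ + 1 => none
  | .natom p, 0 => some (.natom p)
  | .natom _, _ + 1 => none
  | .conj A B, n => if n < A.size then A.letterAt n else B.letterAt (n - A.size)
  | .disj A B, n => if n < A.size then A.letterAt n else B.letterAt (n - A.size)

/-- Directions for addressing subformula occurrences. -/
inductive Dir : Type
  | l
  | r
deriving DecidableEq

/-- The subformula occurrence of a formula at a given position (path). -/
def Form.subAt {P : Type} : Form P → List Dir → Option (Form P)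
  | A, [] => some A
  | .conj A _, .l :: π => A.subAt π
  | .conj _ B, .r :: π => B.subAt π
  | .disj A _, .l :: π => A.subAt π
  | .disj _ B, .r :: π => B.subAt π
  | .pos _, _ :: _ => none
  | .natom _, _ :: _ => none

/-- The number of letter occurrences strictly to the left of the subformula
occurrence at a given position. -/
def Form.offsetAt {P : Type} : Form P → List Dir → ℕ
  | _, [] => 0
  | .conj A _, .l :: π => A.offsetAt π
  | .conj A B, .r :: π => A.size + B.offsetAt π
  | .disj A _, .l :: π => A.offsetAt π
  | .disj A B, .r :: π => A.size + B.offsetAt π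
  | .pos _, _ :: _ => 0
  | .natom _, _ :: _ => 0

/-- The `(n+1)`-th occurrence of a letter in `A` is *linked* in `f : A ⊢ B` to the
`(m+1)`-th occurrence of the same letter in `B` when `{n_s, m_t}` belongs to the
partition corresponding to `Gf`. -/
def Linked {P : Type} {A B : Form P} (f : Term P A B) (n m : ℕ) : Prop :=
  Term.G f (Sum.inl n) (Sum.inr m)

/-- `f` is an arrow term of DS^{¬p}: it contains none of the primitive arrow
terms `Δ̂∧` and `Σ̂∨`. -/
def IsDSTerm {P : Type} : ∀ {A B : Form P}, Term P A B → Prop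
  | _, _, .delta _ _ => False
  | _, _, .sigma _ _ => False
  | _, _, .comp g f => IsDSTerm g ∧ IsDSTerm f
  | _, _, .conj f g => IsDSTerm f ∧ IsDSTerm g
  | _, _, .disj f g => IsDSTerm f ∧ IsDSTerm g
  | _, _, _ => True
/-! ### Ξ̂∧-terms and Θ̂∨-terms, with the positions and the path of the crown -/

/-- `IsXiConjTerm p g kp kn cp` says that `g` is a `Ξ̂∧_{p,B}`-term (a β-term whose
head is one of `Δ̂∧_{p,B}`, `Δ̂∧′_{p,B}`, `Σ̂∧_{p,B}`, `Σ̂∧′_{p,B}`), that within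
the *target* of `g` the occurrence of `p` in the crown of the head has position
`kp` and the occurrence of `¬p` has position `kn` (0-based, among letter
occurrences), and that the crown of the head is the subformula occurrence of the
target of `g` at the path `cp`. -/
inductive IsXiConjTerm {P : Type} (p : P) :
    ∀ {A B : Form P}, Term P A B → ℕ → ℕ → List Dir → Prop
  | delta (B : Form P) :
      IsXiConjTerm p (Term.delta p B) (B.size + 1) B.size [Dir.r]
  | delta' (B : Form P) :
      IsXiConjTerm p (delta' p B) B.size (B.size + 1) [Dir.r]
  | sigmaConj (B : Form P) :
      IsXiConjTerm p (sigmaConj p B) 1 0 [Dir.l]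
  | sigmaConj' (B : Form P) :
      IsXiConjTerm p (sigmaConj' p B) 0 1 [Dir.l]
  | conjL (A : Form P) {C D : Form P} {g : Term P C D} {kp kn : ℕ} {cp : List Dir} :
      IsXiConjTerm p g kp kn cp →
      IsXiConjTerm p (Term.id A ⊼ g) (A.size + kp) (A.size + kn) (Dir.r :: cp)
  | conjR (A : Form P) {C D : Form P} {g : Term P C D} {kp kn : ℕ} {cp : List Dir} :
      IsXiConjTerm p g kp kn cp →
      IsXiConjTerm p (g ⊼ Term.id A) kp kn (Dir.l :: cp)
  | disjL (A : Form P) {C D : Form P} {g : Term P C D} {kp kn : ℕ} {cp : List Dir} :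
      IsXiConjTerm p g kp kn cp →
      IsXiConjTerm p (Term.id A ⊽ g) (A.size + kp) (A.size + kn) (Dir.r :: cp)
  | disjR (A : Form P) {C D : Form P} {g : Term P C D} {kp kn : ℕ} {cp : List Dir} :
      IsXiConjTerm p g kp kn cp →
      IsXiConjTerm p (g ⊽ Term.id A) kp kn (Dir.l :: cp)

/-- `IsThetaDisjTerm p g kp kn cp` says that `g` is a `Θ̂∨_{p,B}`-term (a β-term
whose head is one of `Σ̂∨_{p,B}`, `Σ̂∨′_{p,B}`, `Δ̂∨_{p,B}`, `Δ̂∨′_{p,B}`), that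
within the *source* of `g` the occurrence of `p` in the crown of the head has
position `kp` and the occurrence of `¬p` has position `kn`, and that the crown of
the head is the subformula occurrence of the source of `g` at the path `cp`. -/
inductive IsThetaDisjTerm {P : Type} (p : P) :
    ∀ {A B : Form P}, Term P A B → ℕ → ℕ → List Dir → Prop
  | sigma (B : Form P) :
      IsThetaDisjTerm p (Term.sigma p B) 0 1 [Dir.l]
  | sigma' (B : Form P) :
      IsThetaDisjTerm p (sigma' p B) 1 0 [Dir.l]
  | deltaDisj (B : Form P) :
      IsThetaDisjTerm p (deltaDisj p B) B.size (B.size + 1) [Dir.r]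
  | deltaDisj' (B : Form P) :
      IsThetaDisjTerm p (deltaDisj' p B) (B.size + 1) B.size [Dir.r]
  | conjL (A : Form P) {C D : Form P} {g : Term P C D} {kp kn : ℕ} {cp : List Dir} :
      IsThetaDisjTerm p g kp kn cp →
      IsThetaDisjTerm p (Term.id A ⊼ g) (A.size + kp) (A.size + kn) (Dir.r :: cp)
  | conjR (A : Form P) {C D : Form P} {g : Term P C D} {kp kn : ℕ} {cp : List Dir} :
      IsThetaDisjTerm p g kp kn cp →
      IsThetaDisjTerm p (g ⊼ Term.id A) kp kn (Dir.l :: cp)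
  | disjL (A : Form P) {C D : Form P} {g : Term P C D} {kp kn : ℕ} {cp : List Dir} :
      IsThetaDisjTerm p g kp kn cp →
      IsThetaDisjTerm p (Term.id A ⊽ g) (A.size + kp) (A.size + kn) (Dir.r :: cp)
  | disjR (A : Form P) {C D : Form P} {g : Term P C D} {kp kn : ℕ} {cp : List Dir} :
      IsThetaDisjTerm p g kp kn cp →
      IsThetaDisjTerm p (g ⊽ Term.id A) kp kn (Dir.l :: cp)


open CategoryTheory

/-! ### The quotient category -/

section Quot
variable {P : Type}

def eqvSetoid (A B : Form P) : Setoid (Term P A B) :=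
  ⟨Eqv, Eqv.refl, Eqv.symm, Eqv.trans⟩

def QHom (A B : Form P) : Type := Quotient (eqvSetoid A B)

def mk {A B : Form P} (f : Term P A B) : QHom A B := Quotient.mk (eqvSetoid A B) f

theorem mk_eq {A B : Form P} {f g : Term P A B} (h : Eqv f g) : mk f = mk g :=
  Quotient.sound (s := eqvSetoid A B) h

theorem eqv_of_mk {A B : Form P} {f g : Term P A B} (h : mk f = mk g) : Eqv f g :=
  Quotient.exact (s := eqvSetoid A B) h

theorem QHom.ind {A B : Form P} {motive : QHom A B → Prop} (h : ∀ f : Term P A B, motive (mk f))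
    (x : QHom A B) : motive x := Quotient.ind (s := eqvSetoid A B) h x

def QHom.comp {A B C : Form P} (x : QHom A B) (y : QHom B C) : QHom A C :=
  Quotient.map₂ (sa := eqvSetoid A B) (sb := eqvSetoid B C) (sc := eqvSetoid A C)
    (fun f g => Term.comp g f) (fun _ _ h _ _ h' => Eqv.congComp h' h) x y

instance : Category (Form P) where
  Hom := QHom
  id A := mk (Term.id A)
  comp := QHom.comp
  id_comp x := by
    induction x using QHom.ind with
    | h f => exact mk_eq (Eqv.catIdR f)
  comp_id x := by
    induction x using QHom.ind with
    | h f => exact mk_eq (Eqv.catIdL f)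
  assoc x y z := by
    induction x using QHom.ind with
    | h f =>
      induction y using QHom.ind with
      | h g =>
        induction z using QHom.ind with
        | h k => exact mk_eq (Eqv.catAssoc f g k)

instance formQuiver : Quiver (Form P) := CategoryStruct.toQuiver

def qm {A B : Form P} (f : Term P A B) : A ⟶ B := mk f

def cm {A B D E : Form P} (x : A ⟶ D) (y : B ⟶ E) : A ⋏ B ⟶ D ⋏ E :=
  Quotient.map₂ (sa := eqvSetoid A D) (sb := eqvSetoid B E) (sc := eqvSetoid (A ⋏ B) (D ⋏ E))
    (fun f g => Term.conj f g) (fun _ _ h _ _ h' => Eqv.congConj h h') x y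

def dm {A B D E : Form P} (x : A ⟶ D) (y : B ⟶ E) : A ⋎ B ⟶ D ⋎ E :=
  Quotient.map₂ (sa := eqvSetoid A D) (sb := eqvSetoid B E) (sc := eqvSetoid (A ⋎ B) (D ⋎ E))
    (fun f g => Term.disj f g) (fun _ _ h _ _ h' => Eqv.congDisj h h') x y

infixr:82 " ⩕ " => cm
infixr:82 " ⩖ " => dm

theorem hom_ind {A B : Form P} {motive : (A ⟶ B) → Prop} (h : ∀ f : Term P A B, motive (qm f))
    (x : A ⟶ B) : motive x := Quotient.ind (s := eqvSetoid A B) h x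

theorem qm_eq {A B : Form P} {f g : Term P A B} (h : Eqv f g) : qm f = qm g := mk_eq h
theorem eqv_of_qm {A B : Form P} {f g : Term P A B} (h : qm f = qm g) : Eqv f g := eqv_of_mk h
theorem qm_id (A : Form P) : qm (Term.id A) = 𝟙 A := rfl
theorem qm_comp {A B C : Form P} (g : Term P B C) (f : Term P A B) :
    qm (g ⬝ f) = qm f ≫ qm g := rfl
theorem qm_conj {A B D E : Form P} (f : Term P A D) (g : Term P B E) :
    qm (f ⊼ g) = qm f ⩕ qm g := rfl
theorem qm_disj {A B D E : Form P} (f : Term P A D) (g : Term P B E) :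
    qm (f ⊽ g) = qm f ⩖ qm g := rfl

def af (A B C : Form P) : (A ⋏ B) ⋏ C ⟶ A ⋏ (B ⋏ C) := qm (Term.bConjFrom A B C)
def at' (A B C : Form P) : A ⋏ (B ⋏ C) ⟶ (A ⋏ B) ⋏ C := qm (Term.bConjTo A B C)
def bf (A B C : Form P) : (A ⋎ B) ⋎ C ⟶ A ⋎ (B ⋎ C) := qm (Term.bDisjFrom A B C)
def bt (A B C : Form P) : A ⋎ (B ⋎ C) ⟶ (A ⋎ B) ⋎ C := qm (Term.bDisjTo A B C)
def cc (A B : Form P) : A ⋏ B ⟶ B ⋏ A := qm (Term.cConj A B)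
def gg (A B : Form P) : A ⋎ B ⟶ B ⋎ A := qm (Term.cDisj B A)
def dd (A B C : Form P) : A ⋏ (B ⋎ C) ⟶ (A ⋏ B) ⋎ C := qm (Term.d A B C)
def dl (p : P) (A : Form P) : A ⟶ A ⋏ (Form.natom p ⋎ Form.pos p) := qm (Term.delta p A)
def sg (p : P) (A : Form P) : (Form.pos p ⋏ Form.natom p) ⋎ A ⟶ A := qm (Term.sigma p A)

theorem cm_id (A B : Form P) : 𝟙 A ⩕ 𝟙 B = 𝟙 (A ⋏ B) := qm_eq (Eqv.conjOne A B)
theorem dm_id (A B : Form P) : 𝟙 A ⩖ 𝟙 B = 𝟙 (A ⋎ B) := qm_eq (Eqv.disjOne A B)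

theorem cm_comp {A₁ B₁ C₁ A₂ B₂ C₂ : Form P} (f₁ : A₁ ⟶ B₁) (g₁ : B₁ ⟶ C₁)
    (f₂ : A₂ ⟶ B₂) (g₂ : B₂ ⟶ C₂) : (f₁ ⩕ f₂) ≫ (g₁ ⩕ g₂) = (f₁ ≫ g₁) ⩕ (f₂ ≫ g₂) := by
  induction f₁ using hom_ind; induction g₁ using hom_ind
  induction f₂ using hom_ind; induction g₂ using hom_ind
  exact (qm_eq (Eqv.conjTwo _ _ _ _)).symm

theorem dm_comp {A₁ B₁ C₁ A₂ B₂ C₂ : Form P} (f₁ : A₁ ⟶ B₁) (g₁ : B₁ ⟶ C₁)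
    (f₂ : A₂ ⟶ B₂) (g₂ : B₂ ⟶ C₂) : (f₁ ⩖ f₂) ≫ (g₁ ⩖ g₂) = (f₁ ≫ g₁) ⩖ (f₂ ≫ g₂) := by
  induction f₁ using hom_ind; induction g₁ using hom_ind
  induction f₂ using hom_ind; induction g₂ using hom_ind
  exact (qm_eq (Eqv.disjTwo _ _ _ _)).symm

theorem cm_comp_assoc {A₁ B₁ C₁ A₂ B₂ C₂ Z : Form P} (f₁ : A₁ ⟶ B₁) (g₁ : B₁ ⟶ C₁)
    (f₂ : A₂ ⟶ B₂) (g₂ : B₂ ⟶ C₂) (z : C₁ ⋏ C₂ ⟶ Z) :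
    (f₁ ⩕ f₂) ≫ (g₁ ⩕ g₂) ≫ z = ((f₁ ≫ g₁) ⩕ (f₂ ≫ g₂)) ≫ z := by
  rw [← cm_comp, Category.assoc]

theorem dm_comp_assoc {A₁ B₁ C₁ A₂ B₂ C₂ Z : Form P} (f₁ : A₁ ⟶ B₁) (g₁ : B₁ ⟶ C₁)
    (f₂ : A₂ ⟶ B₂) (g₂ : B₂ ⟶ C₂) (z : C₁ ⋎ C₂ ⟶ Z) :
    (f₁ ⩖ f₂) ≫ (g₁ ⩖ g₂) ≫ z = ((f₁ ≫ g₁) ⩖ (f₂ ≫ g₂)) ≫ z := by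
  rw [← dm_comp, Category.assoc]

/-! isomorphisms -/
theorem at_af (A B C : Form P) : at' A B C ≫ af A B C = 𝟙 _ := qm_eq (Eqv.bConjIso₁ A B C)
theorem af_at (A B C : Form P) : af A B C ≫ at' A B C = 𝟙 _ := qm_eq (Eqv.bConjIso₂ A B C)
theorem bt_bf (A B C : Form P) : bt A B C ≫ bf A B C = 𝟙 _ := qm_eq (Eqv.bDisjIso₁ A B C)
theorem bf_bt (A B C : Form P) : bf A B C ≫ bt A B C = 𝟙 _ := qm_eq (Eqv.bDisjIso₂ A B C)
theorem cc_cc (A B : Form P) : cc A B ≫ cc B A = 𝟙 _ := qm_eq (Eqv.cConjIso A B)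
theorem gg_gg (A B : Form P) : gg A B ≫ gg B A = 𝟙 _ := qm_eq (Eqv.cDisjIso A B)

section
variable {Z : Form P}
theorem at_af_assoc (A B C : Form P) (z : _ ⟶ Z) : at' A B C ≫ af A B C ≫ z = z := by
  rw [← Category.assoc, at_af, Category.id_comp]
theorem af_at_assoc (A B C : Form P) (z : _ ⟶ Z) : af A B C ≫ at' A B C ≫ z = z := by
  rw [← Category.assoc, af_at, Category.id_comp]
theorem bt_bf_assoc (A B C : Form P) (z : _ ⟶ Z) : bt A B C ≫ bf A B C ≫ z = z := by
  rw [← Category.assoc, bt_bf, Category.id_comp]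
theorem bf_bt_assoc (A B C : Form P) (z : _ ⟶ Z) : bf A B C ≫ bt A B C ≫ z = z := by
  rw [← Category.assoc, bf_bt, Category.id_comp]
theorem cc_cc_assoc (A B : Form P) (z : _ ⟶ Z) : cc A B ≫ cc B A ≫ z = z := by
  rw [← Category.assoc, cc_cc, Category.id_comp]
theorem gg_gg_assoc (A B : Form P) (z : _ ⟶ Z) : gg A B ≫ gg B A ≫ z = z := by
  rw [← Category.assoc, gg_gg, Category.id_comp]
end

/-! naturality (structure map first on the right-hand side) -/
section nat
variable {A B C D E F Z : Form P}

theorem at_nat (f : A ⟶ D) (g : B ⟶ E) (h : C ⟶ F) :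
    (f ⩕ (g ⩕ h)) ≫ at' D E F = at' A B C ≫ ((f ⩕ g) ⩕ h) := by
  induction f using hom_ind; induction g using hom_ind; induction h using hom_ind
  exact (qm_eq (Eqv.bConjNat _ _ _)).symm
theorem bt_nat (f : A ⟶ D) (g : B ⟶ E) (h : C ⟶ F) :
    (f ⩖ (g ⩖ h)) ≫ bt D E F = bt A B C ≫ ((f ⩖ g) ⩖ h) := by
  induction f using hom_ind; induction g using hom_ind; induction h using hom_ind
  exact (qm_eq (Eqv.bDisjNat _ _ _)).symm
theorem dd_nat (f : A ⟶ D) (g : B ⟶ E) (h : C ⟶ F) :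
    (f ⩕ (g ⩖ h)) ≫ dd D E F = dd A B C ≫ ((f ⩕ g) ⩖ h) := by
  induction f using hom_ind; induction g using hom_ind; induction h using hom_ind
  exact (qm_eq (Eqv.dNat _ _ _)).symm
theorem cc_nat (f : A ⟶ D) (g : B ⟶ E) : (f ⩕ g) ≫ cc D E = cc A B ≫ (g ⩕ f) := by
  induction f using hom_ind; induction g using hom_ind
  exact (qm_eq (Eqv.cConjNat _ _)).symm
theorem gg_nat (f : A ⟶ D) (g : B ⟶ E) : (f ⩖ g) ≫ gg D E = gg A B ≫ (g ⩖ f) := by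
  induction f using hom_ind; induction g using hom_ind
  exact (qm_eq (Eqv.cDisjNat _ _)).symm
theorem af_nat (f : A ⟶ D) (g : B ⟶ E) (h : C ⟶ F) :
    ((f ⩕ g) ⩕ h) ≫ af D E F = af A B C ≫ (f ⩕ (g ⩕ h)) := by
  rw [← af_at_assoc A B C (((f ⩕ g) ⩕ h) ≫ _), ← Category.assoc (at' A B C), ← at_nat,
    Category.assoc, at_af, Category.comp_id]
theorem bf_nat (f : A ⟶ D) (g : B ⟶ E) (h : C ⟶ F) :
    ((f ⩖ g) ⩖ h) ≫ bf D E F = bf A B C ≫ (f ⩖ (g ⩖ h)) := by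
  rw [← bf_bt_assoc A B C (((f ⩖ g) ⩖ h) ≫ _), ← Category.assoc (bt A B C), ← bt_nat,
    Category.assoc, bt_bf, Category.comp_id]

theorem at_nat_assoc (f : A ⟶ D) (g : B ⟶ E) (h : C ⟶ F) (z : _ ⟶ Z) :
    (f ⩕ (g ⩕ h)) ≫ at' D E F ≫ z = at' A B C ≫ ((f ⩕ g) ⩕ h) ≫ z := by
  rw [← Category.assoc, at_nat, Category.assoc]
theorem bt_nat_assoc (f : A ⟶ D) (g : B ⟶ E) (h : C ⟶ F) (z : _ ⟶ Z) :
    (f ⩖ (g ⩖ h)) ≫ bt D E F ≫ z = bt A B C ≫ ((f ⩖ g) ⩖ h) ≫ z := by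
  rw [← Category.assoc, bt_nat, Category.assoc]
theorem af_nat_assoc (f : A ⟶ D) (g : B ⟶ E) (h : C ⟶ F) (z : _ ⟶ Z) :
    ((f ⩕ g) ⩕ h) ≫ af D E F ≫ z = af A B C ≫ (f ⩕ (g ⩕ h)) ≫ z := by
  rw [← Category.assoc, af_nat, Category.assoc]
theorem bf_nat_assoc (f : A ⟶ D) (g : B ⟶ E) (h : C ⟶ F) (z : _ ⟶ Z) :
    ((f ⩖ g) ⩖ h) ≫ bf D E F ≫ z = bf A B C ≫ (f ⩖ (g ⩖ h)) ≫ z := by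
  rw [← Category.assoc, bf_nat, Category.assoc]
theorem dd_nat_assoc (f : A ⟶ D) (g : B ⟶ E) (h : C ⟶ F) (z : _ ⟶ Z) :
    (f ⩕ (g ⩖ h)) ≫ dd D E F ≫ z = dd A B C ≫ ((f ⩕ g) ⩖ h) ≫ z := by
  rw [← Category.assoc, dd_nat, Category.assoc]
theorem cc_nat_assoc (f : A ⟶ D) (g : B ⟶ E) (z : _ ⟶ Z) :
    (f ⩕ g) ≫ cc D E ≫ z = cc A B ≫ (g ⩕ f) ≫ z := by
  rw [← Category.assoc, cc_nat, Category.assoc]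
theorem gg_nat_assoc (f : A ⟶ D) (g : B ⟶ E) (z : _ ⟶ Z) :
    (f ⩖ g) ≫ gg D E ≫ z = gg A B ≫ (g ⩖ f) ≫ z := by
  rw [← Category.assoc, gg_nat, Category.assoc]
theorem dl_nat (p : P) (f : A ⟶ D) : dl p A ≫ (f ⩕ 𝟙 _) = f ≫ dl p D := by
  induction f using hom_ind; exact qm_eq (Eqv.deltaNat p _)
theorem sg_nat (p : P) (f : A ⟶ D) : (𝟙 _ ⩖ f) ≫ sg p D = sg p A ≫ f := by
  induction f using hom_ind; exact (qm_eq (Eqv.sigmaNat p _)).symm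
end nat

/-! further axioms -/
theorem af_pent (A B C D : Form P) : af (A ⋏ B) C D ≫ af A B (C ⋏ D) =
    (af A B C ⩕ 𝟙 D) ≫ af A (B ⋏ C) D ≫ (𝟙 A ⩕ af B C D) := by
  rw [← Category.assoc]; exact qm_eq (Eqv.bConjPent A B C D)
theorem bf_pent (A B C D : Form P) : bf (A ⋎ B) C D ≫ bf A B (C ⋎ D) =
    (bf A B C ⩖ 𝟙 D) ≫ bf A (B ⋎ C) D ≫ (𝟙 A ⩖ bf B C D) := by
  rw [← Category.assoc]; exact qm_eq (Eqv.bDisjPent A B C D)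
theorem af_hex (A B C : Form P) : (cc B A ⩕ 𝟙 C) ≫ af A B C ≫ cc A (B ⋏ C) ≫ af B C A ≫
    (𝟙 B ⩕ cc C A) = af B A C := by
  simp only [← Category.assoc]
  exact qm_eq (Eqv.bcConj A B C)
theorem bf_hex (A B C : Form P) : (gg B A ⩖ 𝟙 C) ≫ bf A B C ≫ gg A (B ⋎ C) ≫ bf B C A ≫
    (𝟙 B ⩖ gg C A) = bf B A C := by
  simp only [← Category.assoc]
  exact qm_eq (Eqv.bcDisj A B C)

def ddR (C B A : Form P) : (C ⋎ B) ⋏ A ⟶ C ⋎ (B ⋏ A) := qm (dR C B A)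
theorem ddR_eq (C B A : Form P) : ddR C B A = cc (C ⋎ B) A ≫ (𝟙 A ⩕ gg C B) ≫ dd A B C ≫
    (cc A B ⩖ 𝟙 C) ≫ gg (B ⋏ A) C := by
  simp only [← Category.assoc]; rfl

theorem dd_conj (A B C D : Form P) : dd (A ⋏ B) C D ≫ (af A B C ⩖ 𝟙 D) =
    af A B (C ⋎ D) ≫ (𝟙 A ⩕ dd B C D) ≫ dd A (B ⋏ C) D := by
  rw [← Category.assoc (af A B _)]; exact qm_eq (Eqv.dConj A B C D)
theorem dd_disj (D C B A : Form P) : (𝟙 D ⩕ bf C B A) ≫ dd D C (B ⋎ A) =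
    dd D (C ⋎ B) A ≫ (dd D C B ⩖ 𝟙 A) ≫ bf (D ⋏ C) B A := by
  rw [← Category.assoc (dd D (C ⋎ B) A)]; exact qm_eq (Eqv.dDisj D C B A)
theorem dd_bconj (A B C D : Form P) : (dd A B C ⩕ 𝟙 D) ≫ ddR (A ⋏ B) C D =
    af A (B ⋎ C) D ≫ (𝟙 A ⩕ ddR B C D) ≫ dd A B (C ⋏ D) := by
  rw [← Category.assoc (af _ _ _)]; exact qm_eq (Eqv.dBConj A B C D)
theorem dd_bdisj (D C B A : Form P) : ddR D C (B ⋎ A) ≫ (𝟙 D ⩖ dd C B A) =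
    dd (D ⋎ C) B A ≫ (ddR D C B ⩖ 𝟙 A) ≫ bf D (C ⋏ B) A := by
  rw [← Category.assoc (dd _ _ _)]; exact qm_eq (Eqv.dBDisj D C B A)
theorem dl_af (A B : Form P) (p : P) : dl p (A ⋏ B) ≫ af A B _ = 𝟙 A ⩕ dl p B :=
  qm_eq (Eqv.bDelta A B p)
theorem bf_sg (p : P) (B A : Form P) : bf _ B A ≫ sg p (B ⋎ A) = sg p B ⩖ 𝟙 A :=
  qm_eq (Eqv.bSigma p B A)
theorem dl_cc_dd (p : P) (B C : Form P) :
    dl p (B ⋎ C) ≫ cc _ _ ≫ dd _ B C = (dl p B ≫ cc _ _) ⩖ 𝟙 C := by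
  rw [← Category.assoc]; exact qm_eq (Eqv.dSigmaConj p B C)
theorem dd_gg_sg (p : P) (C B : Form P) :
    dd C B _ ≫ gg _ _ ≫ sg p (C ⋏ B) = 𝟙 C ⩕ (gg _ _ ≫ sg p B) := by
  exact qm_eq (Eqv.dDeltaDisj p C B)
theorem dl_dd_sg (p : P) : dl p (Form.pos p) ≫ dd _ _ _ ≫ sg p _ = 𝟙 _ := by
  rw [← Category.assoc]; exact qm_eq (Eqv.sigmaDelta p)
theorem dl_dd_sg' (p : P) : dl p (Form.natom p) ≫ (𝟙 _ ⩕ gg _ _) ≫ dd _ _ _ ≫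
    (cc _ _ ⩖ 𝟙 _) ≫ sg p _ = 𝟙 _ := by
  simp only [← Category.assoc]; 
  rw [Category.assoc _ _ (sg _ _)]
  exact qm_eq (Eqv.sigmaDelta' p)

/-! ### DS arrows -/
def DS {A B : Form P} (x : A ⟶ B) : Prop := ∃ f : Term P A B, IsDSTerm f ∧ qm f = x

theorem ds_qm {A B : Form P} {f : Term P A B} (h : IsDSTerm f) : DS (qm f) := ⟨f, h, rfl⟩
theorem ds_id (A : Form P) : DS (𝟙 A) := ⟨Term.id A, trivial, rfl⟩
theorem ds_comp {A B C : Form P} {x : A ⟶ B} {y : B ⟶ C} : DS x → DS y → DS (x ≫ y)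
  | ⟨f, hf, ef⟩, ⟨g, hg, eg⟩ => ⟨g ⬝ f, ⟨hg, hf⟩, by rw [qm_comp, ef, eg]⟩
theorem ds_cm {A B D E : Form P} {x : A ⟶ D} {y : B ⟶ E} : DS x → DS y → DS (x ⩕ y)
  | ⟨f, hf, ef⟩, ⟨g, hg, eg⟩ => ⟨f ⊼ g, ⟨hf, hg⟩, by rw [qm_conj, ef, eg]⟩
theorem ds_dm {A B D E : Form P} {x : A ⟶ D} {y : B ⟶ E} : DS x → DS y → DS (x ⩖ y)
  | ⟨f, hf, ef⟩, ⟨g, hg, eg⟩ => ⟨f ⊽ g, ⟨hf, hg⟩, by rw [qm_disj, ef, eg]⟩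
theorem ds_af (A B C : Form P) : DS (af A B C) := ⟨Term.bConjFrom A B C, trivial, rfl⟩
theorem ds_at (A B C : Form P) : DS (at' A B C) := ⟨Term.bConjTo A B C, trivial, rfl⟩
theorem ds_bf (A B C : Form P) : DS (bf A B C) := ⟨Term.bDisjFrom A B C, trivial, rfl⟩
theorem ds_bt (A B C : Form P) : DS (bt A B C) := ⟨Term.bDisjTo A B C, trivial, rfl⟩
theorem ds_cc (A B : Form P) : DS (cc A B) := ⟨Term.cConj A B, trivial, rfl⟩
theorem ds_gg (A B : Form P) : DS (gg A B) := ⟨Term.cDisj B A, trivial, rfl⟩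
theorem ds_dd (A B C : Form P) : DS (dd A B C) := ⟨Term.d A B C, trivial, rfl⟩

end Quot

open CategoryTheory

section Frames
variable {P : Type}

attribute [local simp] ds_id ds_comp ds_cm ds_dm ds_af ds_at ds_bf ds_bt ds_cc ds_gg ds_dd

theorem ds_ddR (A B C : Form P) : DS (ddR A B C) := by simp (maxDischargeDepth := 30) [ddR_eq]

theorem inv_eq {A B : Form P} {x : A ⟶ B} {y y' : B ⟶ A} (h : x ≫ y = 𝟙 A) (h' : y' ≫ x = 𝟙 B) :
    y = y' := by
  rw [← Category.id_comp y, ← h', Category.assoc, h, Category.comp_id]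

theorem af_hex' (A B C : Form P) : af A B C ≫ cc A (B ⋏ C) ≫ af B C A =
    (cc A B ⩕ 𝟙 C) ≫ af B A C ≫ (𝟙 B ⩕ cc A C) := by
  rw [← af_hex A B C]
  simp [cm_comp, cm_comp_assoc, cc_cc, cm_id]
theorem bf_hex' (A B C : Form P) : bf A B C ≫ gg A (B ⋎ C) ≫ bf B C A =
    (gg A B ⩖ 𝟙 C) ≫ bf B A C ≫ (𝟙 B ⩖ gg A C) := by
  rw [← bf_hex A B C]
  simp [dm_comp, dm_comp_assoc, gg_gg, dm_id]

theorem at_hex (A B C : Form P) : at' B C A ≫ cc (B ⋏ C) A ≫ at' A B C =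
    (𝟙 B ⩕ cc C A) ≫ at' B A C ≫ (cc B A ⩕ 𝟙 C) := by
  apply inv_eq (x := af A B C ≫ cc A (B ⋏ C) ≫ af B C A)
  · simp [af_at_assoc, cc_cc_assoc, af_at]
  · rw [af_hex']; simp [cm_comp_assoc, cm_comp, cc_cc, cm_id, at_af_assoc]
theorem bt_hex (A B C : Form P) : bt B C A ≫ gg (B ⋎ C) A ≫ bt A B C =
    (𝟙 B ⩖ gg C A) ≫ bt B A C ≫ (gg B A ⩖ 𝟙 C) := by
  apply inv_eq (x := bf A B C ≫ gg A (B ⋎ C) ≫ bf B C A)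
  · simp [bf_bt_assoc, gg_gg_assoc, bf_bt]
  · rw [bf_hex']; simp [dm_comp_assoc, dm_comp, gg_gg, dm_id, bt_bf_assoc]

theorem cc_hex (A B C : Form P) : cc (B ⋏ C) A =
    af B C A ≫ (𝟙 B ⩕ cc C A) ≫ at' B A C ≫ (cc B A ⩕ 𝟙 C) ≫ af A B C := by
  have := congrArg (fun x => af B C A ≫ x ≫ af A B C) (at_hex A B C)
  simpa [at_af, af_at_assoc] using this
theorem gg_hex (A B C : Form P) : gg (B ⋎ C) A =
    bf B C A ≫ (𝟙 B ⩖ gg C A) ≫ bt B A C ≫ (gg B A ⩖ 𝟙 C) ≫ bf A B C := by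
  have := congrArg (fun x => bf B C A ≫ x ≫ bf A B C) (bt_hex A B C)
  simpa [bt_bf, bf_bt_assoc] using this

/-- bFrom expressed through bTo and commutativities -/
theorem af_eq (C X Y : Form P) : af C X Y = cc (C ⋏ X) Y ≫ (𝟙 Y ⩕ cc C X) ≫ at' Y X C ≫
    cc (Y ⋏ X) C ≫ (𝟙 C ⩕ cc Y X) := by
  rw [cc_hex C Y X, cc_hex Y C X]
  simp [at_af_assoc, af_at_assoc, cm_comp_assoc, cc_cc, cm_id, cm_comp]
theorem bf_eq (C X Y : Form P) : bf C X Y = gg (C ⋎ X) Y ≫ (𝟙 Y ⩖ gg C X) ≫ bt Y X C ≫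
    gg (Y ⋎ X) C ≫ (𝟙 C ⩖ gg Y X) := by
  rw [gg_hex C Y X, gg_hex Y C X]
  simp [bt_bf_assoc, bf_bt_assoc, dm_comp_assoc, gg_gg, dm_id, dm_comp]

/-- One-layer contexts. `s = true` means that the hole is on the left. -/
inductive Fr (P : Type) : Type
  | a (s : Bool) (C : Form P) : Fr P
  | o (s : Bool) (C : Form P) : Fr P

@[reducible] def Fr.app : Fr P → Form P → Form P
  | .a true C, X => X ⋏ C
  | .a false C, X => C ⋏ X
  | .o true C, X => X ⋎ C
  | .o false C, X => C ⋎ X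

def Fr.off : Fr P → ℕ
  | .a true _ => 0
  | .a false C => C.size
  | .o true _ => 0
  | .o false C => C.size

def Fr.isO : Fr P → Bool
  | .a _ _ => false
  | .o _ _ => true

def Fr.map : ∀ (fr : Fr P) {X Y : Form P}, (X ⟶ Y) → (fr.app X ⟶ fr.app Y)
  | .a true C, _, _, f => f ⩕ 𝟙 C
  | .a false C, _, _, f => 𝟙 C ⩕ f
  | .o true C, _, _, f => f ⩖ 𝟙 C
  | .o false C, _, _, f => 𝟙 C ⩖ f

def sR : ∀ (fr : Fr P) (E X : Form P), E ⋏ fr.app X ⟶ fr.app (E ⋏ X)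
  | .a true C, E, X => at' E X C
  | .a false C, E, X => (𝟙 E ⩕ cc C X) ≫ at' E X C ≫ cc (E ⋏ X) C
  | .o true C, E, X => dd E X C
  | .o false C, E, X => (𝟙 E ⩕ gg C X) ≫ dd E X C ≫ gg (E ⋏ X) C

def sL (fr : Fr P) (X Y : Form P) : fr.app X ⋏ Y ⟶ fr.app (X ⋏ Y) :=
  cc (fr.app X) Y ≫ sR fr Y X ≫ fr.map (cc Y X)

theorem map_id (fr : Fr P) (X : Form P) : fr.map (𝟙 X) = 𝟙 _ := by
  rcases fr with ⟨_ | _, C⟩ | ⟨_ | _, C⟩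
  all_goals first | exact cm_id _ _ | exact dm_id _ _

theorem map_comp (fr : Fr P) {X Y Z : Form P} (f : X ⟶ Y) (g : Y ⟶ Z) :
    fr.map f ≫ fr.map g = fr.map (f ≫ g) := by
  rcases fr with ⟨_ | _, C⟩ | ⟨_ | _, C⟩ <;>
  first
  | exact (cm_comp _ _ _ _).trans (by rw [Category.id_comp]; rfl)
  | exact (dm_comp _ _ _ _).trans (by rw [Category.id_comp]; rfl)

theorem map_comp_assoc (fr : Fr P) {X Y Z W : Form P} (f : X ⟶ Y) (g : Y ⟶ Z)
    (z : fr.app Z ⟶ W) : fr.map f ≫ fr.map g ≫ z = fr.map (f ≫ g) ≫ z := by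
  rw [← Category.assoc, map_comp]

theorem ds_map (fr : Fr P) {X Y : Form P} {f : X ⟶ Y} (h : DS f) : DS (fr.map f) := by
  rcases fr with ⟨_ | _, C⟩ | ⟨_ | _, C⟩ <;> simp [Fr.map, h]
theorem ds_sR (fr : Fr P) (X Y : Form P) : DS (sR fr X Y) := by
  rcases fr with ⟨_ | _, C⟩ | ⟨_ | _, C⟩ <;> simp [sR]
attribute [local simp] ds_map ds_sR
theorem ds_sL (fr : Fr P) (X Y : Form P) : DS (sL fr X Y) := by simp (maxDischargeDepth := 30) [sL]

theorem sR_nat (fr : Fr P) {E E' X X' : Form P} (f : E ⟶ E') (g : X ⟶ X') :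
    (f ⩕ fr.map g) ≫ sR fr E' X' = sR fr E X ≫ fr.map (f ⩕ g) := by
  rcases fr with ⟨_ | _, C⟩ | ⟨_ | _, C⟩
  · simp only [Fr.map, sR, Category.assoc, cm_comp_assoc, cc_nat, Category.comp_id]
    rw [← cc_nat (f ⩕ g), ← at_nat_assoc, cm_comp_assoc, Category.id_comp]
  · exact at_nat _ _ _
  · simp only [Fr.map, sR, Category.assoc, cm_comp_assoc, gg_nat, Category.comp_id]
    rw [← gg_nat (f ⩕ g), ← dd_nat_assoc, cm_comp_assoc, Category.id_comp]
  · exact dd_nat _ _ _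

theorem sR_nat_assoc (fr : Fr P) {E E' X X' W : Form P} (f : E ⟶ E') (g : X ⟶ X')
    (z : _ ⟶ W) :
    (f ⩕ fr.map g) ≫ sR fr E' X' ≫ z = sR fr E X ≫ fr.map (f ⩕ g) ≫ z := by
  rw [← Category.assoc, sR_nat, Category.assoc]

theorem sL_nat (fr : Fr P) {E E' X X' : Form P} (f : E ⟶ E') (g : X ⟶ X') :
    (fr.map g ⩕ f) ≫ sL fr X' E' = sL fr X E ≫ fr.map (g ⩕ f) := by
  simp only [sL, cc_nat_assoc, sR_nat_assoc, map_comp, cc_nat, Category.assoc]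

theorem sL_nat_assoc (fr : Fr P) {E E' X X' W : Form P} (f : E ⟶ E') (g : X ⟶ X')
    (z : _ ⟶ W) :
    (fr.map g ⩕ f) ≫ sL fr X' E' ≫ z = sL fr X E ≫ fr.map (g ⩕ f) ≫ z := by
  rw [← Category.assoc, sL_nat, Category.assoc]

theorem sR_nat1 (fr : Fr P) {E E' X : Form P} (f : E ⟶ E') :
    (f ⩕ 𝟙 (fr.app X)) ≫ sR fr E' X = sR fr E X ≫ fr.map (f ⩕ 𝟙 X) := by
  rw [← sR_nat, map_id]
theorem sL_nat1 (fr : Fr P) {E E' X : Form P} (f : E ⟶ E') :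
    (𝟙 (fr.app X) ⩕ f) ≫ sL fr X E' = sL fr X E ≫ fr.map (𝟙 X ⩕ f) := by
  rw [← sL_nat, map_id]
theorem sR_nat1_assoc (fr : Fr P) {E E' X W : Form P} (f : E ⟶ E') (z : _ ⟶ W) :
    (f ⩕ 𝟙 (fr.app X)) ≫ sR fr E' X ≫ z = sR fr E X ≫ fr.map (f ⩕ 𝟙 X) ≫ z := by
  rw [← Category.assoc, sR_nat1, Category.assoc]
theorem sL_nat1_assoc (fr : Fr P) {E E' X W : Form P} (f : E ⟶ E') (z : _ ⟶ W) :
    (𝟙 (fr.app X) ⩕ f) ≫ sL fr X E' ≫ z = sL fr X E ≫ fr.map (𝟙 X ⩕ f) ≫ z := by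
  rw [← Category.assoc, sL_nat1, Category.assoc]

theorem cc_sL (fr : Fr P) (X Y : Form P) :
    cc Y (fr.app X) ≫ sL fr X Y = sR fr Y X ≫ fr.map (cc Y X) := by
  simp [sL, cc_cc_assoc]
theorem cc_sR (fr : Fr P) (X Y : Form P) :
    cc (fr.app X) Y ≫ sR fr Y X = sL fr X Y ≫ fr.map (cc X Y) := by
  simp [sL, map_comp, cc_cc, map_id]
theorem cc_sL_assoc (fr : Fr P) (X Y : Form P) {W : Form P} (z : _ ⟶ W) :
    cc Y (fr.app X) ≫ sL fr X Y ≫ z = sR fr Y X ≫ fr.map (cc Y X) ≫ z := by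
  rw [← Category.assoc, cc_sL, Category.assoc]
theorem cc_sR_assoc (fr : Fr P) (X Y : Form P) {W : Form P} (z : _ ⟶ W) :
    cc (fr.app X) Y ≫ sR fr Y X ≫ z = sL fr X Y ≫ fr.map (cc X Y) ≫ z := by
  rw [← Category.assoc, cc_sR, Category.assoc]

theorem sL_a_false (C X Y : Form P) : sL (.a false C) X Y = af C X Y := by
  rw [af_eq]; simp only [sL, sR, Fr.map, Category.assoc]
theorem sL_o_false (C X Y : Form P) : sL (.o false C) X Y = ddR C X Y := by
  rw [ddR_eq, gg_nat]; simp only [sL, sR, Fr.map, Category.assoc]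

/-- Isomorphic frames, compatible with strengths. -/
structure FrIso (fr fr' : Fr P) where
  i : ∀ X, fr.app X ⟶ fr'.app X
  j : ∀ X, fr'.app X ⟶ fr.app X
  ij : ∀ X, i X ≫ j X = 𝟙 _
  ji : ∀ X, j X ≫ i X = 𝟙 _
  di : ∀ X, DS (i X)
  dj : ∀ X, DS (j X)
  ni : ∀ {X Y : Form P} (f : X ⟶ Y), fr.map f ≫ i Y = i X ≫ fr'.map f
  si : ∀ E X, (𝟙 E ⩕ i X) ≫ sR fr' E X = sR fr E X ≫ i (E ⋏ X)

def FrIso.rfl' (fr : Fr P) : FrIso fr fr where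
  i X := 𝟙 _
  j X := 𝟙 _
  ij X := by simp
  ji X := by simp
  di X := ds_id _
  dj X := ds_id _
  ni f := by simp
  si E X := by simp [cm_id]

def FrIso.a (C : Form P) : FrIso (.a true C) (.a false C) where
  i X := cc X C
  j X := cc C X
  ij X := cc_cc _ _
  ji X := cc_cc _ _
  di X := ds_cc _ _
  dj X := ds_cc _ _
  ni f := cc_nat _ _
  si E X := by simp [sR, cm_comp_assoc, cc_cc, cm_id]

def FrIso.o (C : Form P) : FrIso (.o true C) (.o false C) where
  i X := gg X C
  j X := gg C X
  ij X := gg_gg _ _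
  ji X := gg_gg _ _
  di X := ds_gg _ _
  dj X := ds_gg _ _
  ni f := gg_nat _ _
  si E X := by simp [sR, cm_comp_assoc, gg_gg, cm_id]

def FrIso.symm {fr fr' : Fr P} (I : FrIso fr fr') : FrIso fr' fr where
  i := I.j
  j := I.i
  ij := I.ji
  ji := I.ij
  di := I.dj
  dj := I.di
  ni {X Y} f := by
    have := congrArg (fun x => I.j X ≫ x ≫ I.j Y) (I.ni f)
    simp only [Category.assoc, I.ij, Category.comp_id] at this
    rw [this, ← Category.assoc, I.ji, Category.id_comp]
  si E X := by
    have := congrArg (fun x => (𝟙 E ⩕ I.j X) ≫ x ≫ I.j (E ⋏ X)) (I.si E X)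
    simp only [Category.assoc, I.ij, Category.comp_id, cm_comp_assoc, I.ji, cm_id,
      Category.id_comp] at this
    rw [this]

theorem FrIso.siL {fr fr' : Fr P} (I : FrIso fr fr') (X E : Form P) :
    (I.i X ⩕ 𝟙 E) ≫ sL fr' X E = sL fr X E ≫ I.i (X ⋏ E) := by
  simp only [sL, cc_nat_assoc, Category.assoc, I.ni]
  rw [← Category.assoc (_ ⩕ _), I.si, Category.assoc]

/-- Swapping strengths: a right frame outside a left frame. -/
def SW (fr gr : Fr P) : Prop := ∃ σ : ∀ W, fr.app (gr.app W) ⟶ gr.app (fr.app W),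
  (∀ W, DS (σ W)) ∧
  (∀ {W W' : Form P} (f : W ⟶ W'), fr.map (gr.map f) ≫ σ W' = σ W ≫ gr.map (fr.map f)) ∧
  ∀ X Y, sR gr (fr.app X) Y ≫ gr.map (sL fr X Y) =
    sL fr X (gr.app Y) ≫ fr.map (sR gr X Y) ≫ σ (X ⋏ Y)

theorem SW.transport {fr fr' gr gr' : Fr P} (I : FrIso fr fr') (J : FrIso gr gr')
    (h : SW fr gr) : SW fr' gr' := by
  obtain ⟨σ, ds, nat, e⟩ := h
  refine ⟨fun W => I.j _ ≫ fr.map (J.j W) ≫ σ W ≫ gr.map (I.i W) ≫ J.i _, ?_, ?_, ?_⟩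
  · intro W; simp (maxDischargeDepth := 30) [ds, I.di, I.dj, J.di, J.dj]
  · intro W W' f
    have h1 := I.symm.ni (gr'.map f)
    have h2 := J.symm.ni f
    have h3 := I.ni f
    have h4 := J.ni (fr'.map f)
    simp only [FrIso.symm] at h1 h2
    simp only [Category.assoc, ← h4]
    rw [map_comp_assoc gr, ← h3, ← map_comp_assoc gr, ← reassoc_of% (nat f),
      map_comp_assoc fr (J.j W), ← h2, ← map_comp_assoc fr, reassoc_of% h1]
  · intro X Y
    have key : (I.i X ⩕ J.i Y) ≫ sR gr' (fr'.app X) Y ≫ gr'.map (sL fr' X Y) =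
        (I.i X ⩕ J.i Y) ≫ sL fr' X (gr'.app Y) ≫ fr'.map (sR gr' X Y) ≫
          I.j _ ≫ fr.map (J.j _) ≫ σ _ ≫ gr.map (I.i _) ≫ J.i _ := by
      have e1 : I.i X ⩕ J.i Y = (𝟙 _ ⩕ J.i Y) ≫ (I.i X ⩕ 𝟙 _) := by simp [cm_comp]
      have e2 : I.i X ⩕ J.i Y = (I.i X ⩕ 𝟙 _) ≫ (𝟙 _ ⩕ J.i Y) := by simp [cm_comp]
      conv_lhs => rw [e1]
      conv_rhs => rw [e2]
      simp only [Category.assoc]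
      rw [sR_nat1_assoc, map_comp gr', I.siL, reassoc_of% J.si, ← J.ni, ← map_comp_assoc, 
        reassoc_of% e, sL_nat1_assoc, map_comp_assoc, J.si, reassoc_of% I.siL,
        ← reassoc_of% I.ni, ← map_comp_assoc, reassoc_of% I.ij, map_comp_assoc fr (J.i _), J.ij,
        map_id, Category.id_comp]
    have := congrArg (fun x => (I.j X ⩕ J.j Y) ≫ x) key
    simpa only [cm_comp_assoc, I.ji, J.ji, cm_id, Category.id_comp] using this

theorem sw_aa (C C' : Form P) : SW (.a false C) (.a true C') := by
  refine ⟨fun W => at' C W C', fun W => ds_at _ _ _, fun f => at_nat _ _ _, ?_⟩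
  intro X Y
  simp only [sL_a_false]
  have h := congrArg (fun x => at' _ _ _ ≫ x ≫ (𝟙 _ ⩕ at' _ _ _) ≫ at' _ _ _) (af_pent C X Y C')
  simp only [Category.assoc, at_af_assoc, cm_comp_assoc, Category.id_comp, af_at, af_at_assoc,
    cm_id, Category.comp_id] at h
  exact h.symm
theorem sw_ao (C C' : Form P) : SW (.a false C) (.o true C') := by
  refine ⟨fun W => dd C W C', fun W => ds_dd _ _ _, fun f => dd_nat _ _ _, ?_⟩
  intro X Y
  simp only [sL_a_false]
  exact dd_conj _ _ _ _
theorem sw_oo (C C' : Form P) : SW (.o false C) (.o true C') := by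
  refine ⟨fun W => bt C W C', fun W => ds_bt _ _ _, fun f => bt_nat _ _ _, ?_⟩
  intro X Y
  simp only [sL_o_false]
  have h := congrArg (fun x => x ≫ bt _ _ _) (dd_bdisj C X Y C')
  simp only [Category.assoc, bf_bt, Category.comp_id] at h
  exact h.symm

def frA (s t : Bool) (C : Form P) : FrIso (.a s C) (.a t C) :=
  match s, t with
  | true, true => .rfl' _
  | false, false => .rfl' _
  | true, false => .a _
  | false, true => (FrIso.a _).symm
def frO (s t : Bool) (C : Form P) : FrIso (.o s C) (.o t C) :=
  match s, t with
  | true, true => .rfl' _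
  | false, false => .rfl' _
  | true, false => .o _
  | false, true => (FrIso.o _).symm

theorem sw_all (fr gr : Fr P) (h : fr.isO = false ∨ gr.isO = true) : SW fr gr := by
  rcases fr with ⟨s, C⟩ | ⟨s, C⟩ <;> rcases gr with ⟨t, C'⟩ | ⟨t, C'⟩
  · exact (sw_aa C C').transport (frA _ _ _) (frA _ _ _)
  · exact (sw_ao C C').transport (frA _ _ _) (frO _ _ _)
  · simp [Fr.isO] at h
  · exact (sw_oo C C').transport (frO _ _ _) (frO _ _ _)

/-- The mirrored statement: a left frame outside a right frame. -/
theorem sw_mirror (fr gr : Fr P) (h : gr.isO = false ∨ fr.isO = true) :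
    ∃ σ : ∀ W, gr.app (fr.app W) ⟶ fr.app (gr.app W),
  (∀ W, DS (σ W)) ∧
  (∀ {W W' : Form P} (f : W ⟶ W'), gr.map (fr.map f) ≫ σ W' = σ W ≫ fr.map (gr.map f)) ∧
  ∀ X Y, sL fr X (gr.app Y) ≫ fr.map (sR gr X Y) =
    sR gr (fr.app X) Y ≫ gr.map (sL fr X Y) ≫ σ (X ⋏ Y) := by
  obtain ⟨σ, ds, nat, e⟩ := sw_all gr fr h
  refine ⟨σ, ds, nat, fun X Y => ?_⟩
  have h := congrArg (fun x => cc _ _ ≫ x ≫ fr.map (gr.map (cc Y X))) (e Y X)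
  simp only [Category.assoc, cc_sR_assoc, cc_sL_assoc, map_comp, map_comp_assoc, cc_sL, cc_cc,
    map_id, Category.comp_id, ← nat] at h
  exact h

end Frames

open CategoryTheory

section Coherence
variable {P : Type}

/-! coherence equations used in the pull-back lemma -/

theorem sR_a_false' (A E X : Form P) : sR (.a false A) E X =
    at' E A X ≫ (cc E A ⩕ 𝟙 X) ≫ af A E X := by
  have h := cc_sL (.a false A) X E
  rw [sL_a_false] at h
  have h2 := congrArg (fun x => x ≫ (𝟙 A ⩕ cc X E)) h
  simp only [Fr.map, Category.assoc, cm_comp, cc_cc, cm_id, Category.comp_id] at h2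
  rw [← h2]
  have := af_hex' E A X
  have h3 := congrArg (fun x => at' E A X ≫ x ≫ (𝟙 A ⩕ cc X E)) this
  simp only [Category.assoc, cm_comp, cc_cc, cm_id, Category.comp_id, at_af_assoc] at h3
  exact h3

theorem bt_xa (E A B C : Form P) : (𝟙 E ⩕ bt A B C) ≫ dd E (A ⋎ B) C ≫ (dd E A B ⩖ 𝟙 C) =
    dd E A (B ⋎ C) ≫ bt (E ⋏ A) B C := by
  have h := congrArg (fun x => (𝟙 E ⩕ bt A B C) ≫ x ≫ bt _ _ _) (dd_disj E A B C)
  simp only [Category.assoc, cm_comp_assoc, bt_bf, cm_id, Category.id_comp, bf_bt,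
    Category.comp_id] at h
  exact h.symm
theorem at_xa (E A B C : Form P) : (𝟙 E ⩕ at' A B C) ≫ at' E (A ⋏ B) C ≫ (at' E A B ⩕ 𝟙 C) =
    at' E A (B ⋏ C) ≫ at' (E ⋏ A) B C := by
  symm
  apply inv_eq (x := af (E ⋏ A) B C ≫ af E A (B ⋏ C))
  · simp only [Category.assoc, af_at_assoc, af_at]
  · rw [af_pent]
    simp only [Category.assoc, cm_comp_assoc, at_af, Category.comp_id, cm_id, Category.id_comp,
      at_af_assoc, cm_comp]

theorem bt_gg (A B C : Form P) : bt A B C ≫ (gg A B ⩖ 𝟙 C) =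
    gg A (B ⋎ C) ≫ bf B C A ≫ (𝟙 B ⩖ gg C A) ≫ bt B A C := by
  have h := congrArg (fun x => bt A B C ≫ x ≫ (𝟙 B ⩖ gg C A) ≫ bt B A C) (bf_hex' A B C)
  simp only [Category.assoc, bt_bf_assoc, dm_comp_assoc, gg_gg, dm_id, Category.id_comp, bf_bt,
    Category.comp_id] at h
  exact h.symm
theorem at_cc (A B C : Form P) : at' A B C ≫ (cc A B ⩕ 𝟙 C) =
    cc A (B ⋏ C) ≫ af B C A ≫ (𝟙 B ⩕ cc C A) ≫ at' B A C := by
  have h := congrArg (fun x => at' A B C ≫ x ≫ (𝟙 B ⩕ cc C A) ≫ at' B A C) (af_hex' A B C)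
  simp only [Category.assoc, at_af_assoc, cm_comp_assoc, cc_cc, cm_id, Category.id_comp, af_at,
    Category.comp_id] at h
  exact h.symm

theorem bt_gg2 (A B C : Form P) : bt A B C ≫ gg (A ⋎ B) C =
    gg A (B ⋎ C) ≫ (gg B C ⩖ 𝟙 A) ≫ bf C B A ≫ (𝟙 C ⩖ gg B A) := by
  rw [bf_eq C B A]
  simp only [Category.assoc, dm_comp, gg_gg, dm_id, Category.comp_id, gg_nat_assoc,
    dm_comp_assoc, gg_gg_assoc, Category.id_comp]
theorem at_cc2 (A B C : Form P) : at' A B C ≫ cc (A ⋏ B) C =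
    cc A (B ⋏ C) ≫ (cc B C ⩕ 𝟙 A) ≫ af C B A ≫ (𝟙 C ⩕ cc B A) := by
  rw [af_eq C B A]
  simp only [Category.assoc, cm_comp, cc_cc, cm_id, Category.comp_id, cc_nat_assoc,
    cm_comp_assoc, cc_cc_assoc, Category.id_comp]

theorem bt_xb (E A B C : Form P) :
    (𝟙 E ⩕ bt A B C) ≫ dd E (A ⋎ B) C ≫ (sR (.o false A) E B ⩖ 𝟙 C) =
    sR (.o false A) E (B ⋎ C) ≫ (𝟙 A ⩖ dd E B C) ≫ bt A (E ⋏ B) C := by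
  have h1 : sR (.o false A) E B ⩖ 𝟙 C =
      ((𝟙 E ⩕ gg A B) ⩖ 𝟙 C) ≫ (dd E B A ⩖ 𝟙 C) ≫ (gg (E ⋏ B) A ⩖ 𝟙 C) := by
    simp only [dm_comp, Category.comp_id]; rfl
  rw [h1, ← dd_nat_assoc, cm_comp_assoc, bt_gg]
  have h2 := bt_hex A (E ⋏ B) C
  have h3 := bt_xa E B A C
  have h4 := bt_xa E B C A
  have e1 : (𝟙 E ≫ 𝟙 E) ⩕ (gg A (B ⋎ C) ≫ bf B C A ≫ (𝟙 B ⩖ gg C A) ≫ bt B A C) =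
    (𝟙 E ⩕ (gg A (B ⋎ C) ≫ bf B C A ≫ (𝟙 B ⩖ gg C A))) ≫ (𝟙 E ⩕ bt B A C) := by
    simp [cm_comp]
  rw [e1]
  simp only [Category.assoc]
  rw [reassoc_of% h3]
  have e2 : 𝟙 E ⩕ (gg A (B ⋎ C) ≫ bf B C A ≫ 𝟙 B ⩖ gg C A) =
    (𝟙 E ⩕ gg A (B ⋎ C)) ≫ (𝟙 E ⩕ bf B C A) ≫ (𝟙 E ⩕ (𝟙 B ⩖ gg C A)) := by
    simp [cm_comp]
  rw [e2]
  simp only [Category.assoc, dd_nat_assoc, cm_id]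
  rw [← h2]
  rw [← reassoc_of% h4]
  simp only [cm_comp_assoc, bf_bt, Category.id_comp, cm_id]
  simp only [sR, Category.assoc]
  rw [gg_nat_assoc]

theorem at_xb (E A B C : Form P) :
    (𝟙 E ⩕ at' A B C) ≫ at' E (A ⋏ B) C ≫ (sR (.a false A) E B ⩕ 𝟙 C) =
    sR (.a false A) E (B ⋏ C) ≫ (𝟙 A ⩕ at' E B C) ≫ at' A (E ⋏ B) C := by
  have hp : at' (A ⋏ E) B C ≫ (af A E B ⩕ 𝟙 C) =
      af A E (B ⋏ C) ≫ (𝟙 A ⩕ at' E B C) ≫ at' A (E ⋏ B) C := by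
    have h := congrArg (fun x => at' _ _ _ ≫ x ≫ (𝟙 _ ⩕ at' _ _ _) ≫ at' _ _ _) (af_pent A E B C)
    simp only [Category.assoc, at_af_assoc, cm_comp_assoc, Category.id_comp, af_at,
      cm_id, Category.comp_id] at h
    exact h.symm
  have h1 : sR (.a false A) E B ⩕ 𝟙 C =
      (at' E A B ⩕ 𝟙 C) ≫ ((cc E A ⩕ 𝟙 B) ⩕ 𝟙 C) ≫ (af A E B ⩕ 𝟙 C) := by
    rw [sR_a_false']; simp only [cm_comp, Category.comp_id]
  rw [h1, sR_a_false', reassoc_of% (at_xa E A B C), ← at_nat_assoc, hp]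
  simp only [cm_id, Category.assoc]

theorem bt_tail (A B X : Form P) : bt X B A ≫ (gg X B ⩖ 𝟙 A) ≫ gg (B ⋎ X) A ≫ bt A B X =
    (𝟙 X ⩖ gg B A) ≫ gg X (A ⋎ B) := by
  apply inv_eq (x := bf A B X ≫ gg A (B ⋎ X) ≫ (gg B X ⩖ 𝟙 A) ≫ bf X B A)
  · simp only [Category.assoc, bf_bt_assoc, dm_comp_assoc, gg_gg, dm_id, Category.id_comp,
      gg_gg_assoc, bf_bt]
  · have h := bt_gg2 A B X
    have h' := congrArg (fun x => x ≫ (𝟙 X ⩖ gg A B)) h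
    simp only [Category.assoc, dm_comp, gg_gg, Category.comp_id, dm_id] at h'
    rw [← h', bf_bt_assoc]
    simp only [Category.assoc, gg_gg_assoc, dm_comp, gg_gg, Category.comp_id, dm_id]
theorem at_tail (A B X : Form P) : at' X B A ≫ (cc X B ⩕ 𝟙 A) ≫ cc (B ⋏ X) A ≫ at' A B X =
    (𝟙 X ⩕ cc B A) ≫ cc X (A ⋏ B) := by
  apply inv_eq (x := af A B X ≫ cc A (B ⋏ X) ≫ (cc B X ⩕ 𝟙 A) ≫ af X B A)
  · simp only [Category.assoc, af_at_assoc, cm_comp_assoc, cc_cc, cm_id, Category.id_comp,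
      cc_cc_assoc, af_at]
  · have h := at_cc2 A B X
    have h' := congrArg (fun x => x ≫ (𝟙 X ⩕ cc A B)) h
    simp only [Category.assoc, cm_comp, cc_cc, Category.comp_id, cm_id] at h'
    rw [← h', af_at_assoc]
    simp only [Category.assoc, cc_cc_assoc, cm_comp, cc_cc, Category.comp_id, cm_id]

theorem bt_xc (E A B C : Form P) :
    (𝟙 E ⩕ bt A B C) ≫ sR (.o false (A ⋎ B)) E C =
    sR (.o false A) E (B ⋎ C) ≫ (𝟙 A ⩖ sR (.o false B) E C) ≫ bt A B (E ⋏ C) := by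
  have h1 : 𝟙 A ⩖ sR (.o false B) E C =
      (𝟙 A ⩖ (𝟙 E ⩕ gg B C)) ≫ (𝟙 A ⩖ dd E C B) ≫ (𝟙 A ⩖ gg (E ⋏ C) B) := by
    simp only [dm_comp, Category.comp_id]; rfl
  rw [h1]
  simp only [sR, Category.assoc, cm_comp_assoc, Category.comp_id]
  rw [bt_gg2]
  have h3 := bt_xa E C B A
  have h4 := bt_tail A B (E ⋏ C)
  have e1 : 𝟙 E ⩕ (gg A (B ⋎ C) ≫ (gg B C ⩖ 𝟙 A) ≫ bf C B A ≫ (𝟙 C ⩖ gg B A)) =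
    (𝟙 E ⩕ gg A (B ⋎ C)) ≫ (𝟙 E ⩕ (gg B C ⩖ 𝟙 A)) ≫ (𝟙 E ⩕ bf C B A) ≫
      (𝟙 E ⩕ (𝟙 C ⩖ gg B A)) := by
    simp [cm_comp]
  rw [e1]
  simp only [Category.assoc, dd_nat_assoc, cm_id]
  rw [← h4, ← reassoc_of% h3, cm_comp_assoc (𝟙 E) (𝟙 E) (bf C B A) (bt C B A), bf_bt,
    Category.id_comp, cm_id, Category.id_comp, dd_nat_assoc, ← gg_nat_assoc, ← gg_nat_assoc,
    ← gg_nat_assoc]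
theorem at_xc (E A B C : Form P) :
    (𝟙 E ⩕ at' A B C) ≫ sR (.a false (A ⋏ B)) E C =
    sR (.a false A) E (B ⋏ C) ≫ (𝟙 A ⩕ sR (.a false B) E C) ≫ at' A B (E ⋏ C) := by
  have h1 : 𝟙 A ⩕ sR (.a false B) E C =
      (𝟙 A ⩕ (𝟙 E ⩕ cc B C)) ≫ (𝟙 A ⩕ at' E C B) ≫ (𝟙 A ⩕ cc (E ⋏ C) B) := by
    simp only [cm_comp, Category.comp_id]; rfl
  rw [h1]
  simp only [sR, Category.assoc, cm_comp_assoc, Category.comp_id]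
  rw [at_cc2]
  have h3 := at_xa E C B A
  have h4 := at_tail A B (E ⋏ C)
  have e1 : 𝟙 E ⩕ (cc A (B ⋏ C) ≫ (cc B C ⩕ 𝟙 A) ≫ af C B A ≫ (𝟙 C ⩕ cc B A)) =
    (𝟙 E ⩕ cc A (B ⋏ C)) ≫ (𝟙 E ⩕ (cc B C ⩕ 𝟙 A)) ≫ (𝟙 E ⩕ af C B A) ≫
      (𝟙 E ⩕ (𝟙 C ⩕ cc B A)) := by
    simp [cm_comp]
  rw [e1]
  simp only [Category.assoc, at_nat_assoc, cm_id]
  rw [← h4, ← reassoc_of% h3, cm_comp_assoc (𝟙 E) (𝟙 E) (af C B A) (at' C B A), af_at,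
    Category.id_comp, cm_id, Category.id_comp, at_nat_assoc, ← cc_nat_assoc]
  simp only [cm_comp_assoc, Category.comp_id, Category.assoc]

theorem dd_xa (E A B C : Form P) :
    (𝟙 E ⩕ dd A B C) ≫ dd E (A ⋏ B) C ≫ (at' E A B ⩖ 𝟙 C) = at' E A (B ⋎ C) ≫ dd (E ⋏ A) B C := by
  have h := congrArg (fun x => at' E A (B ⋎ C) ≫ x ≫ (at' E A B ⩖ 𝟙 C)) (dd_conj E A B C)
  simp only [Category.assoc, dm_comp, af_at, dm_id, Category.comp_id, at_af_assoc] at h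
  exact h.symm
theorem dd_xb (E A B C : Form P) :
    (𝟙 E ⩕ dd A B C) ≫ dd E (A ⋏ B) C ≫ (sR (.a false A) E B ⩖ 𝟙 C) =
    sR (.a false A) E (B ⋎ C) ≫ (𝟙 A ⩕ dd E B C) ≫ dd A (E ⋏ B) C := by
  have h1 : sR (.a false A) E B ⩖ 𝟙 C =
      (at' E A B ⩖ 𝟙 C) ≫ ((cc E A ⩕ 𝟙 B) ⩖ 𝟙 C) ≫ (af A E B ⩖ 𝟙 C) := by
    rw [sR_a_false']; simp only [dm_comp, Category.comp_id]
  rw [h1, sR_a_false', reassoc_of% (dd_xa E A B C), ← dd_nat_assoc, dd_conj]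
  simp only [dm_id, Category.assoc]
theorem dd_xc (E A B C : Form P) :
    (𝟙 E ⩕ dd A B C) ≫ sR (.o false (A ⋏ B)) E C =
    sR (.a false A) E (B ⋎ C) ≫ (𝟙 A ⩕ sR (.o false B) E C) ≫ dd A B (E ⋏ C) := by
  have hs : ∀ (fr : Fr P) (X : Form P),
      sR fr E X = cc E (fr.app X) ≫ sL fr X E ≫ fr.map (cc X E) := by
    intro fr X
    rw [cc_sL_assoc, map_comp, cc_cc, map_id, Category.comp_id]
  rw [hs, hs, hs, sL_o_false, sL_a_false, sL_o_false]
  have h := dd_bconj A B C E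
  rw [cc_nat_assoc]
  rw [reassoc_of% h]
  simp only [Fr.map, Category.assoc, cm_comp_assoc, Category.comp_id, cc_cc_assoc]
  have := dd_nat (𝟙 A) (𝟙 B) (cc C E)
  rw [cm_id] at this
  rw [← this, cm_comp_assoc, Category.comp_id]

end Coherence

open CategoryTheory

section HSsec
variable {P : Type}

/-- The two orientations of the contraction of a dual pair of literals. -/
inductive Dual (p : P) : ∀ (a b : Form P), (∀ D, (a ⋏ b) ⋎ D ⟶ D) → Bool → Prop
  | pn : Dual p (.pos p) (.natom p) (fun D => sg p D) false
  | np : Dual p (.natom p) (.pos p) (fun D => (cc _ _ ⩖ 𝟙 D) ≫ sg p D) true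

theorem Dual.sw {p : P} {a b e o} (h : Dual p a b e o) :
    ∃ e', Dual p b a e' (!o) ∧ ∀ D, (cc b a ⩖ 𝟙 D) ≫ e D = e' D := by
  cases h
  · exact ⟨_, .np, fun D => rfl⟩
  · refine ⟨_, .pn, fun D => ?_⟩
    simp [dm_comp_assoc, cc_cc, dm_id]

theorem Dual.nat {p : P} {a b e o} (h : Dual p a b e o) {D D' : Form P} (f : D ⟶ D') :
    (𝟙 _ ⩖ f) ≫ e D' = e D ≫ f := by
  cases h
  · exact sg_nat _ _
  · simp only [Category.assoc, ← sg_nat, dm_comp_assoc, Category.id_comp, Category.comp_id]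

theorem Dual.bf {p : P} {a b e o} (h : Dual p a b e o) (B A : Form P) :
    bf (a ⋏ b) B A ≫ e (B ⋎ A) = e B ⩖ 𝟙 A := by
  cases h
  · exact bf_sg _ _ _
  · have := bf_nat (cc (.natom p) (.pos p)) (𝟙 B) (𝟙 A)
    rw [dm_id] at this
    dsimp only
    rw [← reassoc_of% this, bf_sg, dm_comp, Category.comp_id]

theorem Dual.dd {p : P} {a b e o} (h : Dual p a b e o) (C B : Form P) :
    dd C B (a ⋏ b) ≫ gg _ _ ≫ e (C ⋏ B) = 𝟙 C ⩕ (gg _ _ ≫ e B) := by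
  cases h
  · exact dd_gg_sg _ _ _
  · have := dd_nat (𝟙 C) (𝟙 B) (cc (.natom p) (.pos p))
    rw [cm_id] at this
    dsimp only
    rw [← gg_nat_assoc, ← gg_nat_assoc, ← reassoc_of% this, dd_gg_sg, cm_comp, Category.comp_id]

def eO {a b : Form P} (e : ∀ D, (a ⋏ b) ⋎ D ⟶ D) : ∀ (s : Bool) (D : Form P),
    (Fr.o s D).app (a ⋏ b) ⟶ D
  | true, D => e D
  | false, D => gg _ _ ≫ e D

theorem eO_sw {a b : Form P} {e : ∀ D, (a ⋏ b) ⋎ D ⟶ D} {e' : ∀ D, (b ⋏ a) ⋎ D ⟶ D}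
    (h : ∀ D, (cc b a ⩖ 𝟙 D) ≫ e D = e' D) (s : Bool) (D : Form P) :
    (Fr.o s D).map (cc b a) ≫ eO e s D = eO e' s D := by
  cases s
  · simp only [Fr.map, eO, ← h, gg_nat_assoc]
  · exact h D

theorem Dual.sizeL {p : P} {a b e o} (h : Dual p a b e o) : a.size = 1 := by cases h <;> rfl
theorem Dual.sizeR {p : P} {a b e o} (h : Dual p a b e o) : b.size = 1 := by cases h <;> rfl

inductive HS (p : P) : ∀ {A B Z : Form P}, (A ⋏ B ⟶ Z) → ℕ → ℕ → Bool → Prop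
  | post {A B Z Z' : Form P} {h : A ⋏ B ⟶ Z} {pl pr : ℕ} {o : Bool} (k : Z ⟶ Z') :
      DS k → HS p h pl pr o → HS p (h ≫ k) pl pr o
  | lfr (fr : Fr P) {A B Z : Form P} {h : A ⋏ B ⟶ Z} {pl pr : ℕ} {o : Bool} :
      HS p h pl pr o → HS p (sL fr A B ≫ fr.map h) (fr.off + pl) pr o
  | rfr (fr : Fr P) {A B Z : Form P} {h : A ⋏ B ⟶ Z} {pl pr : ℕ} {o : Bool} :
      HS p h pl pr o → HS p (sR fr A B ≫ fr.map h) pl (fr.off + pr) o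
  | bL {a b : Form P} {e} {o : Bool} (s : Bool) (D : Form P) :
      Dual p a b e o → HS p (sL (.o s D) a b ≫ eO e s D) (Fr.o s D).off 0 o
  | bR {a b : Form P} {e} {o : Bool} (s : Bool) (D : Form P) :
      Dual p a b e o → HS p (sR (.o s D) a b ≫ eO e s D) 0 (Fr.o s D).off o

variable {p : P}

theorem HS.cast {A B Z : Form P} {h h' : A ⋏ B ⟶ Z} {pl pl' pr pr' : ℕ} {o o' : Bool}
    (H : HS p h pl pr o) (e : h' = h) (e1 : pl' = pl) (e2 : pr' = pr) (e3 : o' = o) :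
    HS p h' pl' pr' o' := by
  subst e e1 e2 e3; exact H

theorem HS.sw {A B Z : Form P} {h : A ⋏ B ⟶ Z} {pl pr : ℕ} {o : Bool} (H : HS p h pl pr o) :
    HS p (cc B A ≫ h) pr pl (!o) := by
  induction H with
  | post k hk _ ih => exact (HS.post k hk ih).cast (by simp) rfl rfl rfl
  | lfr fr _ ih => exact (HS.rfr fr ih).cast (by rw [cc_sL_assoc, map_comp]) rfl rfl rfl
  | rfr fr _ ih => exact (HS.lfr fr ih).cast (by rw [cc_sR_assoc, map_comp]) rfl rfl rfl
  | bL s D hd =>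
    obtain ⟨e', hd', he⟩ := hd.sw
    exact (HS.bR s D hd').cast (by rw [cc_sL_assoc, eO_sw he]) rfl rfl rfl
  | bR s D hd =>
    obtain ⟨e', hd', he⟩ := hd.sw
    exact (HS.bL s D hd').cast (by rw [cc_sR_assoc, eO_sw he]) rfl rfl rfl

theorem fr_lt (fr : Fr P) (A : Form P) {n : ℕ} (h : n < A.size) : fr.off + n < (fr.app A).size := by
  rcases fr with ⟨_ | _, C⟩ | ⟨_ | _, C⟩ <;> simp [Fr.off, Form.size] <;> omega

theorem HS.lt {A B Z : Form P} {h : A ⋏ B ⟶ Z} {pl pr : ℕ} {o : Bool} (H : HS p h pl pr o) :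
    pl < A.size ∧ pr < B.size := by
  induction H with
  | post k hk _ ih => exact ih
  | lfr fr _ ih => exact ⟨fr_lt fr _ ih.1, ih.2⟩
  | rfr fr _ ih => exact ⟨ih.1, fr_lt fr _ ih.2⟩
  | bL s D hd => exact ⟨fr_lt (.o s D) _ (n := 0) (by simp [hd.sizeL]), by simp [hd.sizeR]⟩
  | bR s D hd => exact ⟨by simp [hd.sizeL], fr_lt (.o s D) _ (n := 0) (by simp [hd.sizeR])⟩

/-- Elimination for a disjunction on the right. -/
theorem HS.recOr {D1 D2 : Form P}
    {motive : ∀ {E Z : Form P}, (E ⋏ (D1 ⋎ D2) ⟶ Z) → ℕ → ℕ → Bool → Prop}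
    (post : ∀ {E Z Z' : Form P} {h : E ⋏ (D1 ⋎ D2) ⟶ Z} {pl pr o} (k : Z ⟶ Z'), DS k →
      HS p h pl pr o → motive h pl pr o → motive (h ≫ k) pl pr o)
    (lfr : ∀ (fr : Fr P) {E Z : Form P} {h : E ⋏ (D1 ⋎ D2) ⟶ Z} {pl pr o},
      HS p h pl pr o → motive h pl pr o →
      motive (sL fr E _ ≫ fr.map h) (fr.off + pl) pr o)
    (hd1 : ∀ {E Z : Form P} {h : E ⋏ D1 ⟶ Z} {pl pr o}, HS p h pl pr o →
      motive (dd E D1 D2 ≫ (h ⩖ 𝟙 D2)) pl pr o)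
    (hd2 : ∀ {E Z : Form P} {h : E ⋏ D2 ⟶ Z} {pl pr o}, HS p h pl pr o →
      motive (sR (.o false D1) E D2 ≫ (𝟙 D1 ⩖ h)) pl (D1.size + pr) o)
    (b1 : ∀ {a e o}, Dual p a D1 e o → motive (dd a D1 D2 ≫ e D2) 0 0 o)
    (b2 : ∀ {a e o}, Dual p a D2 e o →
      motive (sR (.o false D1) a D2 ≫ gg _ _ ≫ e D1) 0 D1.size o)
    {E Z : Form P} {h : E ⋏ (D1 ⋎ D2) ⟶ Z} {pl pr o} (H : HS p h pl pr o) :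
    motive h pl pr o := by
  have key : ∀ {E D Z : Form P} {h : E ⋏ D ⟶ Z} {pl pr o}, HS p h pl pr o →
      ∀ hD : D = D1 ⋎ D2, motive (hD ▸ h) pl pr o := by
    intro E D Z h pl pr o H
    induction H with
    | post k hk H ih => intro hD; subst hD; exact post k hk H (ih rfl)
    | lfr fr H ih => intro hD; subst hD; exact lfr fr H (ih rfl)
    | rfr fr H ih =>
      intro hD
      rcases fr with ⟨_ | _, C⟩ | ⟨_ | _, C⟩
      · cases hD
      · cases hD
      · cases hD; exact hd2 H
      · cases hD; rw [show (Fr.o true D2).off = 0 from rfl, Nat.zero_add]; exact hd1 H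
    | bL s D hd => intro hD; subst hD; cases hd
    | bR s D hd =>
      intro hD
      cases s
      · cases hD; exact b2 hd
      · cases hD; exact b1 hd
  exact key H rfl

theorem HS.recOr' {D1 D2 : Form P}
    {motive : ∀ (E Z : Form P) (h : E ⋏ (D1 ⋎ D2) ⟶ Z) (pl pr : ℕ) (o : Bool),
      HS p h pl pr o → Prop}
    (post : ∀ {E Z Z' : Form P} {h : E ⋏ (D1 ⋎ D2) ⟶ Z} {pl pr o} (k : Z ⟶ Z'), DS k →
      ∀ H : HS p h pl pr o, motive _ _ h pl pr o H → ∀ H', motive _ _ (h ≫ k) pl pr o H')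
    (lfr : ∀ (fr : Fr P) {E Z : Form P} {h : E ⋏ (D1 ⋎ D2) ⟶ Z} {pl pr o}
      (H : HS p h pl pr o), motive _ _ h pl pr o H →
      ∀ H', motive _ _ (sL fr E _ ≫ fr.map h) (fr.off + pl) pr o H')
    (hd1 : ∀ {E Z : Form P} {h : E ⋏ D1 ⟶ Z} {pl pr o}, HS p h pl pr o →
      ∀ H', motive _ _ (dd E D1 D2 ≫ (h ⩖ 𝟙 D2)) pl pr o H')
    (hd2 : ∀ {E Z : Form P} {h : E ⋏ D2 ⟶ Z} {pl pr o}, HS p h pl pr o →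
      ∀ H', motive _ _ (sR (.o false D1) E D2 ≫ (𝟙 D1 ⩖ h)) pl (D1.size + pr) o H')
    (b1 : ∀ {a e o}, Dual p a D1 e o → ∀ H', motive _ _ (dd a D1 D2 ≫ e D2) 0 0 o H')
    (b2 : ∀ {a e o}, Dual p a D2 e o →
      ∀ H', motive _ _ (sR (.o false D1) a D2 ≫ gg _ _ ≫ e D1) 0 D1.size o H')
    {E Z : Form P} {h : E ⋏ (D1 ⋎ D2) ⟶ Z} {pl pr o} (H : HS p h pl pr o) :
    motive _ _ h pl pr o H :=
  HS.recOr (motive := fun {E Z} h pl pr o => ∀ H : HS p h pl pr o, motive E Z h pl pr o H)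
    (fun k dk H ih => post k dk H (ih H)) (fun fr _ _ _ _ _ _ H ih => lfr fr H (ih H)) hd1 hd2 b1 b2
      H H

theorem push_mirror (fr gr : Fr P) (h : gr.isO = false ∨ fr.isO = true) {X Y W Z : Form P}
    (h0 : X ⋏ Y ⟶ W) (k : gr.app W ⟶ Z) (dk : DS k) : ∃ k' : gr.app (fr.app W) ⟶ fr.app Z, DS k' ∧
    sL fr X (gr.app Y) ≫ fr.map (sR gr X Y ≫ gr.map h0 ≫ k) =
      sR gr (fr.app X) Y ≫ gr.map (sL fr X Y ≫ fr.map h0) ≫ k' := by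
  obtain ⟨σ, ds, nat, es⟩ := sw_mirror fr gr h
  refine ⟨σ _ ≫ fr.map k, ds_comp (ds _) (ds_map _ dk), ?_⟩
  rw [← map_comp, ← map_comp, ← map_comp, reassoc_of% es, Category.assoc, ← reassoc_of% (nat h0)]

theorem push_all (fr gr : Fr P) (h : fr.isO = false ∨ gr.isO = true) {X Y W Z : Form P}
    (h0 : X ⋏ Y ⟶ W) (k : fr.app W ⟶ Z) (dk : DS k) : ∃ k' : fr.app (gr.app W) ⟶ gr.app Z, DS k' ∧
    sR gr (fr.app X) Y ≫ gr.map (sL fr X Y ≫ fr.map h0 ≫ k) =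
      sL fr X (gr.app Y) ≫ fr.map (sR gr X Y ≫ gr.map h0) ≫ k' := by
  obtain ⟨σ, ds, nat, es⟩ := sw_all fr gr h
  refine ⟨σ _ ≫ gr.map k, ds_comp (ds _) (ds_map _ dk), ?_⟩
  rw [← map_comp, ← map_comp, ← map_comp, reassoc_of% es, Category.assoc, ← reassoc_of% (nat h0)]

/-- Conjunction on the right: the frame can be assumed outermost. -/
inductive AndHead (p : P) (E D1 D2 Z : Form P) (h : E ⋏ (D1 ⋏ D2) ⟶ Z) (pl pr : ℕ) (o : Bool) : Prop
  | hd1 {W : Form P} (h0 : E ⋏ D1 ⟶ W) (k : W ⋏ D2 ⟶ Z) (dk : DS k) (H : HS p h0 pl pr o)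
      (e : h = at' E D1 D2 ≫ (h0 ⩕ 𝟙 D2) ≫ k)
  | hd2 {W : Form P} (h0 : E ⋏ D2 ⟶ W) (k : D1 ⋏ W ⟶ Z) (dk : DS k) (pr0 : ℕ) (H : HS p h0 pl pr0 o)
      (e : h = sR (.a false D1) E D2 ≫ (𝟙 D1 ⩕ h0) ≫ k) (hpr : pr = D1.size + pr0)

theorem HS.poR {E D1 D2 Z : Form P} {h : E ⋏ (D1 ⋏ D2) ⟶ Z} {pl pr o} (H : HS p h pl pr o) :
    AndHead p E D1 D2 Z h pl pr o := by
  have key : ∀ {E D Z : Form P} {h : E ⋏ D ⟶ Z} {pl pr o}, HS p h pl pr o →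
      ∀ hD : D = D1 ⋏ D2, AndHead p E D1 D2 Z (hD ▸ h) pl pr o := by
    intro E D Z h pl pr o H
    induction H with
    | post k hk H ih =>
      intro hD; subst hD
      rcases ih rfl with ⟨h0, k', dk, H0, e⟩ | ⟨h0, k', dk, pr0, H0, e, hpr⟩
      · exact .hd1 h0 (k' ≫ k) (ds_comp dk hk) H0 (by dsimp only at e ⊢; simp [e])
      · exact .hd2 h0 (k' ≫ k) (ds_comp dk hk) pr0 H0 (by dsimp only at e ⊢; simp [e]) hpr
    | lfr fr H ih =>
      intro hD; subst hD
      rcases ih rfl with ⟨h0, k', dk, H0, e⟩ | ⟨h0, k', dk, pr0, H0, e, hpr⟩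
      · obtain ⟨k2, dk2, es⟩ := push_mirror fr (.a true D2) (.inl rfl) h0 k' dk
        exact .hd1 _ k2 dk2 (HS.lfr fr H0) (by dsimp only at e ⊢; rw [e]; exact es)
      · obtain ⟨k2, dk2, es⟩ := push_mirror fr (.a false D1) (.inl rfl) h0 k' dk
        exact .hd2 _ k2 dk2 pr0 (HS.lfr fr H0) (by dsimp only at e ⊢; rw [e]; exact es) hpr
    | rfr fr H ih =>
      intro hD
      rcases fr with ⟨_ | _, C⟩ | ⟨_ | _, C⟩
      · cases hD; exact .hd2 _ (𝟙 _) (ds_id _) _ H (by simp [Fr.map]) rfl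
      · cases hD; exact .hd1 _ (𝟙 _) (ds_id _) (by simpa [Fr.off] using H) (by simp [Fr.map, sR])
      · cases hD
      · cases hD
    | bL s D hd => intro hD; subst hD; cases hd
    | bR s D hd =>
      intro hD
      cases s <;> cases hD
  exact key H rfl

end HSsec

open CategoryTheory

section PullRsec
variable {P : Type} {p : P}

theorem dual_e1 {a b e o} (h : Dual p a b e o) (B C : Form P) :
    bt (a ⋏ b) B C ≫ (e B ⩖ 𝟙 C) = e (B ⋎ C) := by
  rw [← h.bf, bt_bf_assoc]

theorem dual_e2 {a b e o} (h : Dual p a b e o) (A C : Form P) :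
    bt A (a ⋏ b) C ≫ ((gg A _ ≫ e A) ⩖ 𝟙 C) = 𝟙 A ⩖ e C := by
  have : ((gg A _ ≫ e A) ⩖ 𝟙 C) = (gg A _ ⩖ 𝟙 C) ≫ (e A ⩖ 𝟙 C) := by simp [dm_comp]
  rw [this, reassoc_of% (bt_gg A (a ⋏ b) C), dual_e1 h, h.nat, reassoc_of% (h.bf C A),
    ← gg_nat_assoc, gg_gg, Category.comp_id]

theorem dual_e3 {a b e o} (h : Dual p a b e o) (A B : Form P) :
    bt A B (a ⋏ b) ≫ gg _ _ ≫ e (A ⋎ B) = 𝟙 A ⩖ (gg B _ ≫ e B) := by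
  rw [reassoc_of% (bt_gg2 A B (a ⋏ b)), h.nat, reassoc_of% (h.bf B A), dm_comp_assoc,
    ← gg_nat_assoc, gg_gg, Category.comp_id, Category.comp_id]

def PullR (p : P) {A D : Form P} (x : A ⟶ D) (φ : ℕ → ℕ) : Prop :=
  ∀ ⦃E Z : Form P⦄ ⦃h : E ⋏ D ⟶ Z⦄ ⦃pl pr o⦄, HS p h pl pr o →
    HS p ((𝟙 E ⩕ x) ≫ h) pl (φ pr) o

theorem PullR.congr {A D : Form P} {x : A ⟶ D} {φ ψ : ℕ → ℕ} (h : PullR p x φ)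
    (e : ∀ m, m < D.size → ψ m = φ m) : PullR p x ψ := by
  intro E Z h' pl pr o H
  rw [e _ H.lt.2]; exact h H

theorem PullR.id (A : Form P) : PullR p (𝟙 A) (fun m => m) := by
  intro E Z h pl pr o H; simpa [cm_id] using H

theorem PullR.comp {A B C : Form P} {x : A ⟶ B} {y : B ⟶ C} {φ ψ : ℕ → ℕ} (hx : PullR p x φ)
    (hy : PullR p y ψ) : PullR p (x ≫ y) (fun m => φ (ψ m)) := by
  intro E Z h pl pr o H
  exact (hx (hy H)).cast (by rw [cm_comp_assoc, Category.id_comp]) rfl rfl rfl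

theorem sR_chgA {E A1 A2 D1 D2 : Form P} (x : A1 ⟶ D1) (y : A2 ⟶ D2) :
    (𝟙 E ⩕ (x ⩕ y)) ≫ sR (.a false D1) E D2 = sR (.a false A1) E A2 ≫ (x ⩕ (𝟙 E ⩕ y)) := by
  simp only [sR, Category.assoc, cm_comp_assoc, cc_nat, Category.comp_id]
  rw [← cc_nat (𝟙 E ⩕ y), ← at_nat_assoc, cm_comp_assoc, Category.id_comp]
theorem sR_chgO {E A1 A2 D1 D2 : Form P} (x : A1 ⟶ D1) (y : A2 ⟶ D2) :
    (𝟙 E ⩕ (x ⩖ y)) ≫ sR (.o false D1) E D2 = sR (.o false A1) E A2 ≫ (x ⩖ (𝟙 E ⩕ y)) := by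
  simp only [sR, Category.assoc, cm_comp_assoc, gg_nat, Category.comp_id]
  rw [← gg_nat (𝟙 E ⩕ y), ← dd_nat_assoc, cm_comp_assoc, Category.id_comp]

theorem PullR.conj {A1 A2 D1 D2 : Form P} {x : A1 ⟶ D1} {y : A2 ⟶ D2} {φ ψ : ℕ → ℕ}
    (dx : DS x) (dy : DS y) (hx : PullR p x φ) (hy : PullR p y ψ) :
    PullR p (x ⩕ y) (fun m => if m < D1.size then φ m else A1.size + ψ (m - D1.size)) := by
  intro E Z h pl pr o H
  rcases H.poR with ⟨h0, k, dk, H0, rfl⟩ | ⟨h0, k, dk, pr0, H0, rfl, rfl⟩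
  · have hl := H0.lt.2
    refine ((HS.rfr (.a true A2) (hx H0)).post ((𝟙 _ ⩕ y) ≫ k)
      (ds_comp (ds_cm (ds_id _) dy) dk)).cast ?_ rfl (by simp [hl, Fr.off]) rfl
    simp only [sR, Fr.map, Category.assoc, at_nat_assoc, cm_comp_assoc, Category.comp_id,
      Category.id_comp]
  · refine ((HS.rfr (.a false A1) (hy H0)).post ((x ⩕ 𝟙 _) ≫ k)
      (ds_comp (ds_cm dx (ds_id _)) dk)).cast ?_ rfl (by simp [Fr.off]) rfl
    rw [reassoc_of% (sR_chgA (E := E) x y)]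
    simp only [Fr.map, Category.assoc, cm_comp_assoc, Category.comp_id,
      Category.id_comp]

theorem HS.iso {fr fr' : Fr P} (I : FrIso fr fr') {E X W Z : Form P} {h0 : E ⋏ X ⟶ W}
    {pl pr o} (H : HS p h0 pl pr o) (k : fr'.app W ⟶ Z) (dk : DS k) :
    HS p ((𝟙 E ⩕ I.i X) ≫ sR fr' E X ≫ fr'.map h0 ≫ k) pl (fr.off + pr) o := by
  refine ((HS.rfr fr H).post (I.i _ ≫ k) (ds_comp (I.di _) dk)).cast ?_ rfl rfl rfl
  rw [reassoc_of% (I.si E X), ← reassoc_of% (I.ni h0), Category.assoc]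

theorem PullR.cc (A B : Form P) :
    PullR p (cc A B) (fun m => if m < B.size then m + A.size else m - B.size) := by
  intro E Z h pl pr o H
  rcases H.poR with ⟨h0, k, dk, H0, rfl⟩ | ⟨h0, k, dk, pr0, H0, rfl, rfl⟩
  · have hl := H0.lt.2
    exact (HS.iso (FrIso.a A).symm H0 k dk).cast rfl rfl (by simp [hl, Fr.off, add_comm]) rfl
  · exact (HS.iso (FrIso.a B) H0 k dk).cast rfl rfl (by simp [Fr.off]) rfl

theorem pull_post {A D : Form P} (x : A ⟶ D) {E Z Z' : Form P} {h : E ⋏ D ⟶ Z}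
    {pl pr o} (k : Z ⟶ Z') (dk : DS k) (H : HS p ((𝟙 E ⩕ x) ≫ h) pl pr o) :
    HS p ((𝟙 E ⩕ x) ≫ h ≫ k) pl pr o := (H.post k dk).cast (by simp) rfl rfl rfl

theorem pull_lfr {A D : Form P} (x : A ⟶ D) (fr : Fr P) {E Z : Form P} {h : E ⋏ D ⟶ Z}
    {pl pr o} (H : HS p ((𝟙 E ⩕ x) ≫ h) pl pr o) :
    HS p ((𝟙 (fr.app E) ⩕ x) ≫ sL fr E D ≫ fr.map h) (fr.off + pl) pr o :=
  (H.lfr fr).cast (by rw [sL_nat1_assoc, map_comp]) rfl rfl rfl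

theorem PullR.gg (A B : Form P) :
    PullR p (gg A B) (fun m => if m < B.size then m + A.size else m - B.size) := by
  intro E Z h pl pr o H
  induction H using HS.recOr' with
  | post k dk _ ih _ => exact pull_post _ k dk ih
  | lfr fr _ ih _ => exact pull_lfr _ fr ih
  | hd1 H0 _ =>
    have hl := H0.lt.2
    refine (HS.iso (FrIso.o A).symm H0 (𝟙 _) (ds_id _)).cast ?_ rfl
      (by simp [hl, Fr.off, add_comm]) rfl
    simp only [Category.comp_id]; rfl
  | hd2 H0 _ =>
    refine (HS.iso (FrIso.o B) H0 (𝟙 _) (ds_id _)).cast ?_ rfl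
      (by simp [Fr.off]) rfl
    simp only [Category.comp_id]; rfl
  | b1 hd _ =>
    refine (HS.bR false A hd).cast ?_ rfl (by simp [hd.sizeR, Fr.off]) rfl
    simp only [sR, eO, Category.assoc, gg_gg_assoc]
  | b2 hd _ =>
    refine (HS.bR true B hd).cast ?_ rfl (by simp [Fr.off]) rfl
    simp only [sR, eO, Category.assoc, gg_gg_assoc, cm_comp_assoc, gg_gg, cm_id,
      Category.id_comp]

def LitOK {A D : Form P} (x : A ⟶ D) (φ : ℕ → ℕ) : Prop :=
  D.size = 1 → ∃ e : A = D, x = eqToHom e ∧ φ 0 = 0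

theorem PullR.disj {A1 A2 D1 D2 : Form P} {x : A1 ⟶ D1} {y : A2 ⟶ D2} {φ ψ : ℕ → ℕ}
    (dx : DS x) (dy : DS y) (hx : PullR p x φ) (hy : PullR p y ψ) (lx : LitOK x φ)
    (ly : LitOK y ψ) :
    PullR p (x ⩖ y) (fun m => if m < D1.size then φ m else A1.size + ψ (m - D1.size)) := by
  intro E Z h pl pr o H
  induction H using HS.recOr' with
  | post k dk _ ih _ => exact pull_post _ k dk ih
  | lfr fr _ ih _ => exact pull_lfr _ fr ih
  | hd1 H0 _ =>
    have hl := H0.lt.2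
    refine ((HS.rfr (.o true A2) (hx H0)).post (𝟙 _ ⩖ y)
      (ds_dm (ds_id _) dy)).cast ?_ rfl (by simp [hl, Fr.off]) rfl
    simp only [sR, Fr.map, Category.assoc, dd_nat_assoc, dm_comp, Category.comp_id,
      Category.id_comp]
  | hd2 H0 _ =>
    refine ((HS.rfr (.o false A1) (hy H0)).post (x ⩖ 𝟙 _)
      (ds_dm dx (ds_id _))).cast ?_ rfl (by simp [Fr.off]) rfl
    rw [reassoc_of% (sR_chgO (E := _) x y)]
    simp only [Fr.map, Category.assoc, dm_comp, Category.comp_id,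
      Category.id_comp]
  | b1 hd _ =>
    obtain ⟨rfl, rfl, h0⟩ := lx hd.sizeR
    refine ((HS.bR true A2 hd).post y dy).cast ?_ rfl (by simp [Fr.off, hd.sizeR, h0]) rfl
    simp only [sR, eO, eqToHom_refl, Category.assoc, ← hd.nat, dd_nat_assoc, cm_id]
  | b2 hd _ =>
    obtain ⟨rfl, rfl, h0⟩ := ly hd.sizeR
    refine ((HS.bR false A1 hd).post x dx).cast ?_ rfl (by simp [Fr.off, h0]) rfl
    rw [eqToHom_refl, reassoc_of% (sR_chgO (E := _) x (𝟙 A2))]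
    simp only [eO, Category.assoc, ← hd.nat, cm_id, gg_nat_assoc]

theorem PullR.at' (A B C : Form P) : PullR p (at' A B C) (fun m => m) := by
  intro E Z h pl pr o H
  rcases H.poR with ⟨h0, k, dk, H0, rfl⟩ | ⟨h0, k, dk, pr0, H0, rfl, rfl⟩
  · rcases H0.poR with ⟨h1, k1, dk1, H1, rfl⟩ | ⟨h1, k1, dk1, pr1, H1, rfl, rfl⟩
    · refine ((HS.rfr (.a true (B ⋏ C)) H1).post (_ ≫ (k1 ⩕ 𝟙 _) ≫ k)
        (ds_comp (ds_at _ _ _) (ds_comp (ds_cm dk1 (ds_id _)) dk))).cast ?_ rfl (by simp [Fr.off]) rfl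
      have e : (_root_.at' E A B ≫ (h1 ⩕ 𝟙 B) ≫ k1) ⩕ 𝟙 C =
        (_root_.at' E A B ⩕ 𝟙 C) ≫ ((h1 ⩕ 𝟙 B) ⩕ 𝟙 C) ≫ (k1 ⩕ 𝟙 C) := by simp [cm_comp]
      rw [e]
      simp only [Category.assoc]
      rw [reassoc_of% (at_xa E A B C), ← at_nat_assoc, cm_id]; rfl
    · refine ((HS.rfr (.a false A) (HS.rfr (.a true C) H1)).post (_ ≫ (k1 ⩕ 𝟙 _) ≫ k)
        (ds_comp (ds_at _ _ _) (ds_comp (ds_cm dk1 (ds_id _)) dk))).cast ?_ rfl (by simp [Fr.off]) rfl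
      have e : (sR (.a false A) E B ≫ (𝟙 A ⩕ h1) ≫ k1) ⩕ 𝟙 C =
        (sR (.a false A) E B ⩕ 𝟙 C) ≫ ((𝟙 A ⩕ h1) ⩕ 𝟙 C) ≫ (k1 ⩕ 𝟙 C) := by simp [cm_comp]
      rw [e]
      simp only [Category.assoc]
      rw [reassoc_of% (at_xb E A B C), ← at_nat_assoc, cm_comp_assoc, Category.id_comp]; rfl
  · refine ((HS.rfr (.a false A) (HS.rfr (.a false B) H0)).post (_ ≫ k)
        (ds_comp (ds_at _ _ _) dk)).cast ?_ rfl (by simp [Fr.off, Form.size, add_assoc]) rfl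
    rw [reassoc_of% (at_xc E A B C), ← cm_id, ← at_nat_assoc, cm_comp_assoc, Category.id_comp,
      Category.assoc]; rfl

theorem PullR.dd (A B C : Form P) : PullR p (dd A B C) (fun m => m) := by
  intro E Z h pl pr o H
  induction H using HS.recOr' with
  | post k dk _ ih _ => exact pull_post _ k dk ih
  | lfr fr _ ih _ => exact pull_lfr _ fr ih
  | @hd1 E Z h pl pr o H0 _ =>
    rcases H0.poR with ⟨h1, k1, dk1, H1, rfl⟩ | ⟨h1, k1, dk1, pr1, H1, rfl, rfl⟩
    · refine ((HS.rfr (.a true (B ⋎ C)) H1).post (_ ≫ (k1 ⩖ 𝟙 _))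
        (ds_comp (ds_dd _ _ _) (ds_dm dk1 (ds_id _)))).cast ?_ rfl (by simp [Fr.off]) rfl
      have e : (_root_.at' E A B ≫ (h1 ⩕ 𝟙 B) ≫ k1) ⩖ 𝟙 C =
        (_root_.at' E A B ⩖ 𝟙 C) ≫ ((h1 ⩕ 𝟙 B) ⩖ 𝟙 C) ≫ (k1 ⩖ 𝟙 C) := by simp [dm_comp]
      rw [e]
      simp only [Category.assoc]
      rw [reassoc_of% (dd_xa E A B C), ← dd_nat_assoc, dm_id]; rfl
    · refine ((HS.rfr (.a false A) (HS.rfr (.o true C) H1)).post (_ ≫ (k1 ⩖ 𝟙 _))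
        (ds_comp (ds_dd _ _ _) (ds_dm dk1 (ds_id _)))).cast ?_ rfl (by simp [Fr.off]) rfl
      have e : (sR (.a false A) E B ≫ (𝟙 A ⩕ h1) ≫ k1) ⩖ 𝟙 C =
        (sR (.a false A) E B ⩖ 𝟙 C) ≫ ((𝟙 A ⩕ h1) ⩖ 𝟙 C) ≫ (k1 ⩖ 𝟙 C) := by simp [dm_comp]
      rw [e]
      simp only [Category.assoc]
      rw [reassoc_of% (dd_xb E A B C), ← dd_nat_assoc, cm_comp_assoc, Category.id_comp]; rfl
  | hd2 H0 _ =>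
    refine ((HS.rfr (.a false A) (HS.rfr (.o false B) H0)).post _
        (ds_dd _ _ _)).cast ?_ rfl (by simp [Fr.off, Form.size, add_assoc]) rfl
    rw [reassoc_of% (dd_xc _ A B C), ← cm_id, ← dd_nat, cm_comp_assoc, Category.id_comp,
      Category.assoc]; rfl
  | b1 hd _ => cases hd
  | b2 hd _ =>
    refine (HS.rfr (.a false A) (HS.bR false B hd)).cast ?_ rfl (by simp [Fr.off, Form.size]) rfl
    rw [reassoc_of% (dd_xc _ A B C), hd.dd, cm_comp, Category.id_comp]; rfl

theorem PullR.bt (A B C : Form P) : PullR p (bt A B C) (fun m => m) := by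
  intro E Z h pl pr o H
  induction H using HS.recOr' with
  | post k dk _ ih _ => exact pull_post _ k dk ih
  | lfr fr _ ih _ => exact pull_lfr _ fr ih
  | @hd1 E Z h pl pr o H0 H' =>
    clear H'
    induction H0 using HS.recOr' with
    | post k dk _ ih _ =>
      exact (ih.post (k ⩖ 𝟙 C) (ds_dm dk (ds_id _))).cast (by simp [dm_comp]) rfl rfl rfl
    | @lfr fr E Z h pl pr o _ ih _ =>
      obtain ⟨k', dk', e⟩ := push_all fr (.o true C) (.inr rfl) h (𝟙 _) (ds_id _)
      rw [Category.comp_id] at e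
      dsimp only
      refine ((ih.lfr fr).post k' dk').cast ?_ rfl rfl rfl
      have e' : _root_.dd (fr.app E) (A ⋎ B) C ≫ ((sL fr E (A ⋎ B) ≫ fr.map h) ⩖ 𝟙 C) =
        sL fr E ((A ⋎ B) ⋎ C) ≫ fr.map (_root_.dd E (A ⋎ B) C ≫ (h ⩖ 𝟙 C)) ≫ k' := e
      rw [e', sL_nat1_assoc, map_comp_assoc, Category.assoc]
    | @hd1 E Z h pl pr o H1 _ =>
      refine ((HS.rfr (.o true (B ⋎ C)) H1).post _
        (ds_bt _ _ _)).cast ?_ rfl (by simp [Fr.off]) rfl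
      have e : (_root_.dd E A B ≫ (h ⩖ 𝟙 B)) ⩖ 𝟙 C =
        (_root_.dd E A B ⩖ 𝟙 C) ≫ ((h ⩖ 𝟙 B) ⩖ 𝟙 C) := by simp [dm_comp]
      rw [e, reassoc_of% (bt_xa E A B C), ← bt_nat, dm_id, Category.assoc]; rfl
    | @hd2 E Z h pl pr o H1 _ =>
      refine ((HS.rfr (.o false A) (HS.rfr (.o true C) H1)).post _
        (ds_bt _ _ _)).cast ?_ rfl (by simp [Fr.off]) rfl
      have e : (sR (.o false A) E B ≫ (𝟙 A ⩖ h)) ⩖ 𝟙 C =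
        (sR (.o false A) E B ⩖ 𝟙 C) ≫ ((𝟙 A ⩖ h) ⩖ 𝟙 C) := by simp [dm_comp]
      rw [e, reassoc_of% (bt_xb E A B C), ← bt_nat, dm_comp_assoc, Category.id_comp,
        Category.assoc]; rfl
    | @b1 a e o hd _ =>
      refine (HS.bR true (B ⋎ C) hd).cast ?_ rfl (by simp [Fr.off]) rfl
      have e : (_root_.dd a A B ≫ e B) ⩖ 𝟙 C =
        (_root_.dd a A B ⩖ 𝟙 C) ≫ (e B ⩖ 𝟙 C) := by simp [dm_comp]
      rw [e, reassoc_of% (bt_xa a A B C), dual_e1 hd]; rfl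
    | @b2 a e o hd _ =>
      refine (HS.rfr (.o false A) (HS.bR true C hd)).cast ?_ rfl (by simp [Fr.off]) rfl
      have e : (sR (.o false A) a B ≫ _root_.gg _ _ ≫ e A) ⩖ 𝟙 C =
        (sR (.o false A) a B ⩖ 𝟙 C) ≫ ((_root_.gg _ _ ≫ e A) ⩖ 𝟙 C) := by simp [dm_comp]
      rw [e, reassoc_of% (bt_xb a A B C), dual_e2 hd, dm_comp, Category.id_comp]; rfl
  | hd2 H0 _ =>
    refine ((HS.rfr (.o false A) (HS.rfr (.o false B) H0)).post _
        (ds_bt _ _ _)).cast ?_ rfl (by simp [Fr.off, Form.size, add_assoc]) rfl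
    rw [reassoc_of% (bt_xc _ A B C), ← dm_id, ← bt_nat, dm_comp_assoc, Category.id_comp,
      Category.assoc]; rfl
  | b1 hd _ => cases hd
  | b2 hd _ =>
    refine (HS.rfr (.o false A) (HS.bR false B hd)).cast ?_ rfl (by simp [Fr.off, Form.size]) rfl
    rw [reassoc_of% (bt_xc _ A B C), dual_e3 hd, dm_comp, Category.id_comp]; rfl

end PullRsec

open CategoryTheory

section Bpos
variable {P : Type} {p : P}

theorem size_pos : ∀ A : Form P, 0 < A.size
  | .pos _ => Nat.one_pos
  | .natom _ => Nat.one_pos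
  | .conj A _ => Nat.add_pos_left (size_pos A) _
  | .disj A _ => Nat.add_pos_left (size_pos A) _

/-- The backward map on positions of letter occurrences induced by a DS term. -/
def bpos : ∀ {A B : Form P}, Term P A B → ℕ → ℕ
  | _, _, .id _, m => m
  | _, _, .comp g f, m => bpos f (bpos g m)
  | _, _, @Term.conj _ A _ D _ f g, m =>
      if m < D.size then bpos f m else A.size + bpos g (m - D.size)
  | _, _, @Term.disj _ A _ D _ f g, m =>
      if m < D.size then bpos f m else A.size + bpos g (m - D.size)
  | _, _, .bConjTo _ _ _, m => m
  | _, _, .bConjFrom _ _ _, m => m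
  | _, _, .bDisjTo _ _ _, m => m
  | _, _, .bDisjFrom _ _ _, m => m
  | _, _, .cConj A B, m => if m < B.size then m + A.size else m - B.size
  | _, _, .cDisj A B, m => if m < A.size then m + B.size else m - A.size
  | _, _, .d _ _ _, m => m
  | _, _, .delta _ _, m => m
  | _, _, .sigma _ _, m => m

theorem bpos_lt {A B : Form P} (f : Term P A B) (hf : IsDSTerm f) :
    ∀ m, m < B.size → bpos f m < A.size := by
  induction f with
  | delta => exact hf.elim
  | sigma => exact hf.elim
  | comp g f ihg ihf => exact fun m hm => ihf hf.2 _ (ihg hf.1 _ hm)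
  | @conj A B D E f g ihf ihg =>
    intro m hm
    simp only [bpos, Form.size] at hm ⊢
    split_ifs with h
    · have := ihf hf.1 _ h; omega
    · have := ihg hf.2 (m - D.size) (by omega); omega
  | @disj A B D E f g ihf ihg =>
    intro m hm
    simp only [bpos, Form.size] at hm ⊢
    split_ifs with h
    · have := ihf hf.1 _ h; omega
    · have := ihg hf.2 (m - D.size) (by omega); omega
  | _ => intro m hm; simp only [bpos, Form.size] at hm ⊢ <;> (try split_ifs) <;> omega

/-- Positions carried by an index of the split equivalence. -/
def tagOf (t : ℕ → ℕ) : ℕ ⊕ ℕ → ℕ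
  | .inl n => n
  | .inr m => t m
def okOf (a b : ℕ) : ℕ ⊕ ℕ → Prop
  | .inl n => n < a
  | .inr m => m < b

def Good (a b : ℕ) (t : ℕ → ℕ) (R : GRel) : Prop :=
  ∀ u v, R u v → okOf a b u ∧ okOf a b v ∧ tagOf t u = tagOf t v

theorem good_id (a a' n : ℕ) (h : a = n) (h' : a' = n) : Good a a' (fun m => m) (gId n) := by
  subst h; subst h'
  rintro u v ⟨i, hi, rfl | rfl, rfl | rfl⟩ <;> simp [okOf, tagOf, hi]

theorem good_swap (a b : ℕ) :
    Good (a + b) (b + a) (fun m => if m < b then m + a else m - b) (gSwap a b) := by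
  have key : ∀ i, i < a + b → (if i < a then i + b else i - a) < b + a ∧
      (if (if i < a then i + b else i - a) < b then (if i < a then i + b else i - a) + a
        else (if i < a then i + b else i - a) - b) = i := by
    intro i hi; constructor <;> split_ifs <;> omega
  rintro u v ⟨i, hi, h1, h2⟩
  obtain ⟨k1, k2⟩ := key i hi
  rcases h1 with rfl | rfl <;> rcases h2 with rfl | rfl
  · exact ⟨hi, hi, rfl⟩
  · exact ⟨hi, k1, k2.symm⟩
  · exact ⟨k1, hi, k2⟩
  · exact ⟨k1, k1, rfl⟩

theorem good_par {a b c d : ℕ} {s t : ℕ → ℕ} {R S : GRel} (hR : Good a b s R) (hS : Good c d t S) :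
    Good (a + c) (b + d) (fun m => if m < b then s m else a + t (m - b)) (gPar a b R S) := by
  rintro u v (h | ⟨u', v', h, rfl, rfl⟩)
  · obtain ⟨h1, h2, h3⟩ := hR _ _ h
    rcases u with n | n <;> rcases v with m | m <;> simp only [okOf, tagOf] at h1 h2 h3 ⊢
    all_goals (try rw [if_pos h1]); (try rw [if_pos h2]); exact ⟨by omega, by omega, h3⟩
  · obtain ⟨h1, h2, h3⟩ := hS _ _ h
    rcases u' with n | n <;> rcases v' with m | m <;>
      simp only [okOf, tagOf, Sum.map_inl, Sum.map_inr, Nat.add_sub_cancel] at h1 h2 h3 ⊢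
    all_goals
      (try rw [if_neg (by omega : ¬ n + b < b)]); (try rw [if_neg (by omega : ¬ m + b < b)])
      exact ⟨by omega, by omega, by omega⟩

theorem good_comp {a b c : ℕ} {s t : ℕ → ℕ} {R S : GRel} (hR : Good a b s R) (hS : Good b c t S) :
    Good a c (fun m => s (t m)) (gComp S R) := by
  intro u v h
  let tg : ℕ ⊕ ℕ ⊕ ℕ → ℕ := fun x => match x with
    | .inl n => n
    | .inr (.inl k) => s k
    | .inr (.inr m) => s (t m)
  let ok : ℕ ⊕ ℕ ⊕ ℕ → Prop := fun x => match x with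
    | .inl n => n < a
    | .inr (.inl k) => k < b
    | .inr (.inr m) => m < c
  have step : ∀ x y : ℕ ⊕ ℕ ⊕ ℕ,
      ((∃ x' y', Sum.map id Sum.inl x' = x ∧ Sum.map id Sum.inl y' = y ∧ R x' y') ∨
      (∃ x' y', Sum.inr x' = x ∧ Sum.inr y' = y ∧ S x' y')) → ok x ∧ ok y ∧ tg x = tg y := by
    rintro x y (⟨x', y', rfl, rfl, h⟩ | ⟨x', y', rfl, rfl, h⟩)
    · obtain ⟨h1, h2, h3⟩ := hR _ _ h
      rcases x' with n | n <;> rcases y' with m | m <;> exact ⟨h1, h2, h3⟩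
    · obtain ⟨h1, h2, h3⟩ := hS _ _ h
      rcases x' with n | n <;> rcases y' with m | m <;> exact ⟨h1, h2, congrArg s h3⟩
  have all : ∀ x y : ℕ ⊕ ℕ ⊕ ℕ, Relation.TransGen (fun x y : ℕ ⊕ ℕ ⊕ ℕ =>
      (∃ x' y', Sum.map id Sum.inl x' = x ∧ Sum.map id Sum.inl y' = y ∧ R x' y') ∨
      (∃ x' y', Sum.inr x' = x ∧ Sum.inr y' = y ∧ S x' y')) x y →
      ok x ∧ ok y ∧ tg x = tg y := by
    intro x y hxy
    induction hxy with
    | single h => exact step _ _ h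
    | tail _ h ih =>
      obtain ⟨h1, h2, h3⟩ := step _ _ h
      exact ⟨ih.1, h2, ih.2.2.trans h3⟩
  obtain ⟨h1, h2, h3⟩ := all _ _ h
  rcases u with n | n <;> rcases v with m | m <;> exact ⟨h1, h2, h3⟩

theorem good_term {A B : Form P} (f : Term P A B) (hf : IsDSTerm f) :
    Good A.size B.size (bpos f) f.G := by
  induction f with
  | delta => exact hf.elim
  | sigma => exact hf.elim
  | comp g f ihg ihf => exact good_comp (s := bpos f) (t := bpos g) (ihf hf.2) (ihg hf.1)
  | conj f g ihf ihg => exact good_par (ihf hf.1) (ihg hf.2)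
  | disj f g ihf ihg => exact good_par (ihf hf.1) (ihg hf.2)
  | cConj => exact good_swap _ _
  | cDisj => exact good_swap _ _
  | _ => exact good_id _ _ _ (by simp [Form.size, add_assoc]) (by simp [Form.size, add_assoc])

theorem linked_bpos {A B : Form P} {f : Term P A B} (hf : IsDSTerm f) {n m : ℕ}
    (h : Linked f n m) : n = bpos f m := (good_term f hf _ _ h).2.2

theorem lit_term {A D : Form P} (f : Term P A D) (hf : IsDSTerm f) (hD : D.size = 1) :
    ∃ e : A = D, qm f = eqToHom e := by
  induction f with
  | delta => exact hf.elim
  | sigma => exact hf.elim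
  | id => exact ⟨rfl, rfl⟩
  | comp g f ihg ihf =>
    obtain ⟨rfl, h⟩ := ihg hf.1 hD
    obtain ⟨rfl, h'⟩ := ihf hf.2 hD
    exact ⟨rfl, by rw [qm_comp, h, h']; simp⟩
  | @conj A B D E => have := size_pos D; have := size_pos E; simp [Form.size] at hD; omega
  | @disj A B D E => have := size_pos D; have := size_pos E; simp [Form.size] at hD; omega
  | bConjTo A B C =>
    have := size_pos A; have := size_pos B; have := size_pos C; simp [Form.size] at hD; omega
  | bConjFrom A B C =>
    have := size_pos A; have := size_pos B; have := size_pos C; simp [Form.size] at hD; omega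
  | bDisjTo A B C =>
    have := size_pos A; have := size_pos B; have := size_pos C; simp [Form.size] at hD; omega
  | bDisjFrom A B C =>
    have := size_pos A; have := size_pos B; have := size_pos C; simp [Form.size] at hD; omega
  | d A B C =>
    have := size_pos A; have := size_pos B; have := size_pos C; simp [Form.size] at hD; omega
  | cConj A B => have := size_pos A; have := size_pos B; simp [Form.size] at hD; omega
  | cDisj A B => have := size_pos A; have := size_pos B; simp [Form.size] at hD; omega

theorem litOK_term {A D : Form P} (f : Term P A D) (hf : IsDSTerm f) :
    LitOK (qm f) (bpos f) := by
  intro hD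
  obtain ⟨rfl, h⟩ := lit_term f hf hD
  have := bpos_lt f hf 0 (by omega)
  exact ⟨rfl, h, by omega⟩

theorem PullR.conj1 {A2 D2 : Form P} (A : Form P) {y : A2 ⟶ D2} {ψ : ℕ → ℕ}
    (dy : DS y) (hy : PullR p y ψ) :
    PullR p (𝟙 A ⩕ y) (fun m => if m < A.size then m else A.size + ψ (m - A.size)) :=
  PullR.conj (ds_id _) dy (PullR.id _) hy

theorem PullR.disj1 {A2 D2 : Form P} (A : Form P) {y : A2 ⟶ D2} {ψ : ℕ → ℕ}
    (dy : DS y) (hy : PullR p y ψ) (ly : LitOK y ψ) :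
    PullR p (𝟙 A ⩖ y) (fun m => if m < A.size then m else A.size + ψ (m - A.size)) :=
  PullR.disj (ds_id _) dy (PullR.id _) hy (fun _ => ⟨rfl, rfl, rfl⟩) ly

theorem PullR.af (C X Y : Form P) : PullR p (af C X Y) (fun m => m) := by
  rw [af_eq]
  refine PullR.congr ((PullR.cc _ _).comp ((PullR.conj1 _ (ds_cc _ _) (PullR.cc _ _)).comp
    ((PullR.at' _ _ _).comp ((PullR.cc _ _).comp
      (PullR.conj1 _ (ds_cc _ _) (PullR.cc _ _)))))) ?_
  intro m hm
  simp only [Form.size] at hm ⊢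
  split_ifs <;> omega

theorem PullR.bf (C X Y : Form P) : PullR p (bf C X Y) (fun m => m) := by
  have l : ∀ A B : Form P, LitOK (_root_.gg A B) (fun m => if m < B.size then m + A.size else m - B.size) := by
    intro A B h
    have := size_pos A; have := size_pos B; simp [Form.size] at h; omega
  rw [bf_eq]
  refine PullR.congr ((PullR.gg _ _).comp ((PullR.disj1 _ (ds_gg _ _) (PullR.gg _ _) (l _ _)).comp
    ((PullR.bt _ _ _).comp ((PullR.gg _ _).comp
      (PullR.disj1 _ (ds_gg _ _) (PullR.gg _ _) (l _ _)))))) ?_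
  intro m hm
  simp only [Form.size] at hm ⊢
  split_ifs <;> omega

theorem pullR_term {A D : Form P} (f : Term P A D) (hf : IsDSTerm f) :
    PullR p (qm f) (bpos f) := by
  induction f with
  | delta => exact hf.elim
  | sigma => exact hf.elim
  | id => exact PullR.id _
  | comp g f ihg ihf => exact (ihf hf.2).comp (ihg hf.1)
  | conj f g ihf ihg => exact PullR.conj (ds_qm hf.1) (ds_qm hf.2) (ihf hf.1) (ihg hf.2)
  | disj f g ihf ihg =>
    exact PullR.disj (ds_qm hf.1) (ds_qm hf.2) (ihf hf.1) (ihg hf.2) (litOK_term _ hf.1)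
      (litOK_term _ hf.2)
  | bConjTo => exact PullR.at' _ _ _
  | bConjFrom => exact PullR.af _ _ _
  | bDisjTo => exact PullR.bt _ _ _
  | bDisjFrom => exact PullR.bf _ _ _
  | cConj => exact PullR.cc _ _
  | cDisj => exact PullR.gg _ _
  | d => exact PullR.dd _ _ _

theorem pullL_term {A D : Form P} (f : Term P A D) (hf : IsDSTerm f)
    {E Z : Form P} {h : D ⋏ E ⟶ Z} {pl pr o} (H : HS p h pl pr o) :
    HS p ((qm f ⩕ 𝟙 E) ≫ h) (bpos f pl) pr o := by
  have h1 := (pullR_term f hf H.sw).sw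
  exact h1.cast (by rw [cc_nat_assoc, cc_cc_assoc]) rfl rfl (by simp)

theorem pullLR_term {A D B E : Form P} (f : Term P A D) (hf : IsDSTerm f)
    (g : Term P B E) (hg : IsDSTerm g) {Z : Form P} {h : D ⋏ E ⟶ Z} {pl pr o}
    (H : HS p h pl pr o) :
    HS p ((qm f ⩕ qm g) ≫ h) (bpos f pl) (bpos g pr) o :=
  (pullL_term f hf (pullR_term g hg H)).cast
    (by rw [cm_comp_assoc, Category.id_comp, Category.comp_id]) rfl rfl rfl

/-- A DS term into a conjunction of two literals is an identity or a symmetry. -/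
theorem lit2_term {a b A D : Form P} (f : Term P A D) (hf : IsDSTerm f)
    (ha : a.size = 1) (hb : b.size = 1) (hD : D = a ⋏ b) :
    (∃ e : A = D, qm f = eqToHom e ∧ ∀ m, m < 2 → bpos f m = m) ∨
    (∃ e : A = b ⋏ a, qm f = eqToHom e ≫ cc b a ≫ eqToHom hD.symm ∧
      ∀ m, m < 2 → bpos f m = 1 - m) := by
  induction f generalizing a b with
  | delta => exact hf.elim
  | sigma => exact hf.elim
  | id => exact .inl ⟨rfl, rfl, fun _ _ => rfl⟩
  | comp g f ihg ihf =>
    subst hD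
    rcases ihg hf.1 ha hb rfl with ⟨rfl, e, h⟩ | ⟨rfl, e, h⟩
    · rcases ihf hf.2 ha hb rfl with ⟨rfl, e', h'⟩ | ⟨rfl, e', h'⟩
      · refine .inl ⟨rfl, by simp [qm_comp, e, e'], fun m hm => ?_⟩
        simp only [bpos]; rw [h _ hm, h' _ hm]
      · refine .inr ⟨rfl, by simp [qm_comp, e, e'], fun m hm => ?_⟩
        simp only [bpos]; rw [h _ hm, h' _ hm]
    · rcases ihf hf.2 hb ha rfl with ⟨rfl, e', h'⟩ | ⟨rfl, e', h'⟩
      · refine .inr ⟨rfl, by simp [qm_comp, e, e'], fun m hm => ?_⟩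
        simp only [bpos]; rw [h _ hm, h' _ (by omega)]
      · refine .inl ⟨rfl, by simp [qm_comp, e, e', cc_cc], fun m hm => ?_⟩
        simp only [bpos]; rw [h _ hm, h' _ (by omega)]; omega
  | conj f g ihf ihg =>
    cases hD
    obtain ⟨rfl, e1, h1⟩ := litOK_term f hf.1 ha
    obtain ⟨rfl, e2, h2⟩ := litOK_term g hf.2 hb
    refine .inl ⟨rfl, by simp [qm_conj, e1, e2, cm_id], fun m hm => ?_⟩
    simp only [bpos, ha]
    obtain rfl | rfl : m = 0 ∨ m = 1 := by omega
    · simp [h1]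
    · simp [h2]
  | cConj A B =>
    cases hD
    refine .inr ⟨rfl, by simp; rfl, fun m hm => ?_⟩
    simp only [bpos, ha, hb]; split_ifs <;> omega
  | bConjTo A B C =>
    cases hD
    have := size_pos A; have := size_pos B; simp [Form.size] at ha; omega
  | bConjFrom A B C =>
    cases hD
    have := size_pos C; have := size_pos B; simp [Form.size] at hb; omega
  | _ => cases hD

end Bpos

open CategoryTheory

section PullHsec
variable {P : Type} {p : P}

/-- Arrows contracting a dual pair, with the position of the positive literal. -/
inductive HH (p : P) : ∀ {G Z : Form P}, (G ⟶ Z) → ℕ → Prop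
  | post {G Z Z' : Form P} {h : G ⟶ Z} {n : ℕ} (k : Z ⟶ Z') :
      DS k → HH p h n → HH p (h ≫ k) n
  | rt {A B Z : Form P} {h : A ⋏ B ⟶ Z} {pl pr : ℕ} {o : Bool} :
      HS p h pl pr o → HH p h (if o then A.size + pr else pl)
  | fr (fr : Fr P) {G Z : Form P} {h : G ⟶ Z} {n : ℕ} :
      HH p h n → HH p (fr.map h) (fr.off + n)
  | bs {a b : Form P} {e} {o : Bool} (s : Bool) (D : Form P) :
      Dual p a b e o → HH p (eO e s D) ((Fr.o s D).off + if o then 1 else 0)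

theorem HH.cast {G Z : Form P} {h h' : G ⟶ Z} {n n' : ℕ}
    (H : HH p h n) (e : h' = h) (e1 : n' = n) : HH p h' n' := by
  subst e e1; exact H

theorem HH.lt {G Z : Form P} {h : G ⟶ Z} {n : ℕ} (H : HH p h n) : n < G.size := by
  induction H with
  | post _ _ _ ih => exact ih
  | rt H => have := H.lt; simp only [Form.size]; split_ifs <;> omega
  | fr fr _ ih => exact fr_lt fr _ ih
  | bs s D hd =>
    refine fr_lt (.o s D) _ ?_
    simp only [Form.size, hd.sizeL, hd.sizeR]; split_ifs <;> omega

inductive AndInv (p : P) (A B Z : Form P) (h : A ⋏ B ⟶ Z) (n : ℕ) : Prop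
  | rt (pl pr : ℕ) (o : Bool) (H : HS p h pl pr o) (hn : n = if o then A.size + pr else pl)
  | l {W : Form P} (h0 : A ⟶ W) (k : W ⋏ B ⟶ Z) (dk : DS k) (H : HH p h0 n)
      (e : h = (h0 ⩕ 𝟙 B) ≫ k)
  | r {W : Form P} (h0 : B ⟶ W) (k : A ⋏ W ⟶ Z) (dk : DS k) (n0 : ℕ) (H : HH p h0 n0)
      (e : h = (𝟙 A ⩕ h0) ≫ k) (hn : n = A.size + n0)

inductive OrInv (p : P) (A B Z : Form P) (h : A ⋎ B ⟶ Z) (n : ℕ) : Prop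
  | l {W : Form P} (h0 : A ⟶ W) (k : W ⋎ B ⟶ Z) (dk : DS k) (H : HH p h0 n)
      (e : h = (h0 ⩖ 𝟙 B) ≫ k)
  | r {W : Form P} (h0 : B ⟶ W) (k : A ⋎ W ⟶ Z) (dk : DS k) (n0 : ℕ) (H : HH p h0 n0)
      (e : h = (𝟙 A ⩖ h0) ≫ k) (hn : n = A.size + n0)
  | bl {a b : Form P} {e} {o : Bool} (hd : Dual p a b e o) (hA : A = a ⋏ b) (k : B ⟶ Z) (dk : DS k)
      (e : h = eqToHom (by rw [hA]) ≫ e B ≫ k) (hn : n = if o then 1 else 0)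
  | br {a b : Form P} {e} {o : Bool} (hd : Dual p a b e o) (hB : B = a ⋏ b) (k : A ⟶ Z) (dk : DS k)
      (e : h = eqToHom (by rw [hB]) ≫ gg _ _ ≫ e A ≫ k) (hn : n = A.size + if o then 1 else 0)

theorem HH.and {A B Z : Form P} {h : A ⋏ B ⟶ Z} {n : ℕ} (H : HH p h n) : AndInv p A B Z h n := by
  have key : ∀ {G Z : Form P} {h : G ⟶ Z} {n}, HH p h n → ∀ hG : G = A ⋏ B,
      AndInv p A B Z (eqToHom hG.symm ≫ h) n := by
    intro G Z h n H
    induction H with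
    | post k dk H ih =>
      intro hG; subst hG
      have ih := ih rfl
      rw [eqToHom_refl, Category.id_comp] at ih ⊢
      rcases ih with ⟨pl, pr, o, H, hn⟩ | ⟨h0, k', dk', H, e⟩ | ⟨h0, k', dk', n0, H, e, hn⟩
      · exact .rt pl pr o (H.post k dk) hn
      · exact .l h0 (k' ≫ k) (ds_comp dk' dk) H (by simp [e])
      · exact .r h0 (k' ≫ k) (ds_comp dk' dk) n0 H (by simp [e]) hn
    | rt H => intro hG; cases hG; exact .rt _ _ _ (by simpa using H) rfl
    | fr fr H ih =>
      intro hG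
      rcases fr with ⟨_ | _, C⟩ | ⟨_ | _, C⟩
      · cases hG; exact .r _ (𝟙 _) (ds_id _) _ H (by simp [Fr.map]) rfl
      · cases hG; exact .l _ (𝟙 _) (ds_id _) (by simpa [Fr.off] using H) (by simp [Fr.map])
      · cases hG
      · cases hG
    | bs s D hd => intro hG; cases s <;> cases hG
  simpa using key H rfl

theorem HH.or {A B Z : Form P} {h : A ⋎ B ⟶ Z} {n : ℕ} (H : HH p h n) : OrInv p A B Z h n := by
  have key : ∀ {G Z : Form P} {h : G ⟶ Z} {n}, HH p h n → ∀ hG : G = A ⋎ B,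
      OrInv p A B Z (eqToHom hG.symm ≫ h) n := by
    intro G Z h n H
    induction H with
    | post k dk H ih =>
      intro hG; subst hG
      have ih := ih rfl
      rw [eqToHom_refl, Category.id_comp] at ih ⊢
      rcases ih with ⟨h0, k', dk', H, e⟩ | ⟨h0, k', dk', n0, H, e, hn⟩ | ⟨hd, rfl, k', dk', e, hn⟩ |
        ⟨hd, rfl, k', dk', e, hn⟩
      · exact .l h0 (k' ≫ k) (ds_comp dk' dk) H (by simp [e])
      · exact .r h0 (k' ≫ k) (ds_comp dk' dk) n0 H (by simp [e]) hn
      · exact .bl hd rfl (k' ≫ k) (ds_comp dk' dk) (by simp [e]) hn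
      · exact .br hd rfl (k' ≫ k) (ds_comp dk' dk) (by simp [e]) hn
    | rt H => intro hG; cases hG
    | fr fr H ih =>
      intro hG
      rcases fr with ⟨_ | _, C⟩ | ⟨_ | _, C⟩
      · cases hG
      · cases hG
      · cases hG; exact .r _ (𝟙 _) (ds_id _) _ H (by simp [Fr.map]) rfl
      · cases hG; exact .l _ (𝟙 _) (ds_id _) (by simpa [Fr.off] using H) (by simp [Fr.map])
    | bs s D hd =>
      intro hG
      cases s <;> cases hG
      · exact .br hd rfl (𝟙 _) (ds_id _) (by simp [eO]) rfl
      · exact .bl hd rfl (𝟙 _) (ds_id _) (by simp [eO]) (by simp [Fr.off])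
  simpa using key H rfl

def PullH (p : P) {A D : Form P} (x : A ⟶ D) (φ : ℕ → ℕ) : Prop :=
  ∀ ⦃Z : Form P⦄ ⦃h : D ⟶ Z⦄ ⦃n⦄, HH p h n → HH p (x ≫ h) (φ n)

theorem PullH.congr {A D : Form P} {x : A ⟶ D} {φ ψ : ℕ → ℕ} (h : PullH p x φ)
    (e : ∀ m, m < D.size → ψ m = φ m) : PullH p x ψ := by
  intro Z h' n H
  rw [e _ H.lt]; exact h H

theorem PullH.id (A : Form P) : PullH p (𝟙 A) (fun m => m) := by
  intro Z h n H; simpa using H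

theorem PullH.comp {A B C : Form P} {x : A ⟶ B} {y : B ⟶ C} {φ ψ : ℕ → ℕ} (hx : PullH p x φ)
    (hy : PullH p y ψ) : PullH p (x ≫ y) (fun m => φ (ψ m)) := by
  intro Z h n H
  exact (hx (hy H)).cast (by simp) rfl

theorem HH.al (C : Form P) {G Z : Form P} {h : G ⟶ Z} {n : ℕ} (H : HH p h n) {Z' : Form P}
    (k : Z ⋏ C ⟶ Z') (dk : DS k) : HH p ((h ⩕ 𝟙 C) ≫ k) n :=
  ((HH.fr (.a true C) H).post k dk).cast rfl (by simp [Fr.off])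
theorem HH.ar (C : Form P) {G Z : Form P} {h : G ⟶ Z} {n : ℕ} (H : HH p h n) {Z' : Form P}
    (k : C ⋏ Z ⟶ Z') (dk : DS k) : HH p ((𝟙 C ⩕ h) ≫ k) (C.size + n) :=
  ((HH.fr (.a false C) H).post k dk).cast rfl rfl
theorem HH.ol (C : Form P) {G Z : Form P} {h : G ⟶ Z} {n : ℕ} (H : HH p h n) {Z' : Form P}
    (k : Z ⋎ C ⟶ Z') (dk : DS k) : HH p ((h ⩖ 𝟙 C) ≫ k) n :=
  ((HH.fr (.o true C) H).post k dk).cast rfl (by simp [Fr.off])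
theorem HH.or' (C : Form P) {G Z : Form P} {h : G ⟶ Z} {n : ℕ} (H : HH p h n) {Z' : Form P}
    (k : C ⋎ Z ⟶ Z') (dk : DS k) : HH p ((𝟙 C ⩖ h) ≫ k) (C.size + n) :=
  ((HH.fr (.o false C) H).post k dk).cast rfl rfl
theorem HH.bl {a b : Form P} {e} {o : Bool} (D : Form P) (hd : Dual p a b e o) {Z : Form P}
    (k : D ⟶ Z) (dk : DS k) : HH p (e D ≫ k) (if o then 1 else 0) :=
  ((HH.bs true D hd).post k dk).cast rfl (by simp [Fr.off])
theorem HH.br {a b : Form P} {e} {o : Bool} (D : Form P) (hd : Dual p a b e o) {Z : Form P}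
    (k : D ⟶ Z) (dk : DS k) : HH p (gg _ _ ≫ e D ≫ k) (D.size + if o then 1 else 0) :=
  ((HH.bs false D hd).post k dk).cast (by simp [eO]) rfl

theorem PullH.conj {A1 A2 D1 D2 : Form P} (f : Term P A1 D1) (g : Term P A2 D2)
    (hf : IsDSTerm f) (hg : IsDSTerm g) (Hf : PullH p (qm f) (bpos f))
    (Hg : PullH p (qm g) (bpos g)) :
    PullH p (qm f ⩕ qm g) (bpos (Term.conj f g)) := by
  intro Z h n Ho
  rcases Ho.and with ⟨pl, pr, o, H, rfl⟩ | ⟨h0, k, dk, H, rfl⟩ | ⟨h0, k, dk, n0, H, rfl, rfl⟩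
  · have hl := H.lt.1
    refine (HH.rt (pullLR_term f hf g hg H)).cast rfl ?_
    cases o <;> simp [bpos, hl]
  · refine ((Hf H).al A2 ((𝟙 _ ⩕ qm g) ≫ k) (ds_comp (ds_cm (ds_id _) (ds_qm hg)) dk)).cast ?_
      (by simp [bpos, H.lt])
    simp only [cm_comp_assoc, Category.comp_id, Category.id_comp]
  · refine ((Hg H).ar A1 ((qm f ⩕ 𝟙 _) ≫ k) (ds_comp (ds_cm (ds_qm hf) (ds_id _)) dk)).cast ?_
      (by simp [bpos])
    simp only [cm_comp_assoc, Category.comp_id, Category.id_comp]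

theorem lit2_pull {a b A E : Form P} {e o} (hd : Dual p a b e o) (f : Term P A (a ⋏ b))
    (hf : IsDSTerm f) : ∃ (a' b' : Form P) (e' : _) (o' : Bool) (_ : Dual p a' b' e' o')
      (hA : A = a' ⋏ b'), (qm f ⩖ 𝟙 E) ≫ e E = eqToHom (by rw [hA]) ≫ e' E ∧
      bpos f (if o then 1 else 0) = (if o' then 1 else 0) := by
  rcases lit2_term f hf hd.sizeL hd.sizeR rfl with ⟨rfl, h, hb⟩ | ⟨rfl, h, hb⟩
  · exact ⟨a, b, e, o, hd, rfl, by simp [h, dm_id], hb _ (by split_ifs <;> omega)⟩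
  · obtain ⟨e', hd', he⟩ := hd.sw
    refine ⟨b, a, e', _, hd', rfl, by simp [h, he], ?_⟩
    rw [hb _ (by split_ifs <;> omega)]
    cases o <;> rfl

theorem PullH.disj {A1 A2 D1 D2 : Form P} (f : Term P A1 D1) (g : Term P A2 D2)
    (hf : IsDSTerm f) (hg : IsDSTerm g) (Hf : PullH p (qm f) (bpos f))
    (Hg : PullH p (qm g) (bpos g)) :
    PullH p (qm f ⩖ qm g) (bpos (Term.disj f g)) := by
  intro Z h n Ho
  rcases Ho.or with ⟨h0, k, dk, H, rfl⟩ | ⟨h0, k, dk, n0, H, rfl, rfl⟩ | ⟨hd, rfl, k, dk, rfl, rfl⟩ |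
        ⟨hd, rfl, k, dk, rfl, rfl⟩
  · refine ((Hf H).ol A2 ((𝟙 _ ⩖ qm g) ≫ k) (ds_comp (ds_dm (ds_id _) (ds_qm hg)) dk)).cast ?_
      (by simp [bpos, H.lt])
    simp only [dm_comp_assoc, Category.comp_id, Category.id_comp]
  · refine ((Hg H).or' A1 ((qm f ⩖ 𝟙 _) ≫ k) (ds_comp (ds_dm (ds_qm hf) (ds_id _)) dk)).cast ?_
      (by simp [bpos])
    simp only [dm_comp_assoc, Category.comp_id, Category.id_comp]
  · rename_i a b e o
    obtain ⟨a', b', e', o', hd', rfl, h1, h2⟩ := lit2_pull (E := D2) hd f hf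
    refine (HH.bl A2 hd' (qm g ≫ k) (ds_comp (ds_qm hg) dk)).cast ?_ ?_
    · have : qm f ⩖ qm g = (𝟙 _ ⩖ qm g) ≫ (qm f ⩖ 𝟙 _) := by simp [dm_comp]
      rw [eqToHom_refl, Category.id_comp, this, Category.assoc, reassoc_of% h1, eqToHom_refl,
        Category.id_comp, reassoc_of% (hd'.nat (qm g))]
    · have : (if o then 1 else 0) < (a ⋏ b).size := by
        simp only [Form.size, hd.sizeL, hd.sizeR]; split_ifs <;> omega
      simp only [bpos]
      rw [if_pos this, h2]
  · rename_i a b e o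
    obtain ⟨a', b', e', o', hd', rfl, h1, h2⟩ := lit2_pull (E := D1) hd g hg
    refine (HH.br A1 hd' (qm f ≫ k) (ds_comp (ds_qm hf) dk)).cast ?_ ?_
    · have : qm f ⩖ qm g = (qm f ⩖ 𝟙 _) ≫ (𝟙 _ ⩖ qm g) := by simp [dm_comp]
      rw [eqToHom_refl, Category.id_comp, this, Category.assoc, gg_nat_assoc, reassoc_of% h1,
        eqToHom_refl, Category.id_comp, gg_nat_assoc, reassoc_of% (hd'.nat (qm f))]
    · simp only [bpos]
      rw [if_neg (by omega), Nat.add_sub_cancel_left, h2]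

theorem PullH.cc (A B : Form P) : PullH p (cc A B) (bpos (Term.cConj A B)) := by
  intro Z h n Ho
  rcases Ho.and with ⟨pl, pr, o, H, rfl⟩ | ⟨h0, k, dk, H, rfl⟩ | ⟨h0, k, dk, n0, H, rfl, rfl⟩
  · have hl := H.lt.1
    refine (HH.rt H.sw).cast rfl ?_
    cases o <;> simp [bpos, hl, add_comm]
  · refine (H.ar A (_root_.cc _ _ ≫ k) (ds_comp (ds_cc _ _) dk)).cast ?_
      (by simp [bpos, H.lt, add_comm])
    rw [cc_nat_assoc]
  · refine (H.al B (_root_.cc _ _ ≫ k) (ds_comp (ds_cc _ _) dk)).cast ?_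
      (by simp [bpos])
    rw [cc_nat_assoc]

theorem PullH.gg (A B : Form P) : PullH p (gg A B) (bpos (Term.cDisj B A)) := by
  intro Z h n Ho
  rcases Ho.or with ⟨h0, k, dk, H, rfl⟩ | ⟨h0, k, dk, n0, H, rfl, rfl⟩ | ⟨hd, rfl, k, dk, rfl, rfl⟩ |
        ⟨hd, rfl, k, dk, rfl, rfl⟩
  · refine (H.or' A (_root_.gg _ _ ≫ k) (ds_comp (ds_gg _ _) dk)).cast ?_
      (by simp [bpos, H.lt, add_comm])
    rw [gg_nat_assoc]
  · refine (H.ol B (_root_.gg _ _ ≫ k) (ds_comp (ds_gg _ _) dk)).cast ?_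
      (by simp [bpos])
    rw [gg_nat_assoc]
  · rename_i a b e o
    refine (HH.br A hd k dk).cast (by simp) ?_
    have : (if o then 1 else 0) < (a ⋏ b).size := by
        simp only [Form.size, hd.sizeL, hd.sizeR]; split_ifs <;> omega
    simp only [bpos]; rw [if_pos this, add_comm]
  · refine (HH.bl B hd k dk).cast (by simp [gg_gg_assoc]) ?_
    simp [bpos]

theorem PullH.at' (A B C : Form P) : PullH p (at' A B C) (fun m => m) := by
  intro Z h n Ho
  rcases Ho.and with ⟨pl, pr, o, H, rfl⟩ | ⟨h0, k, dk, H, rfl⟩ | ⟨h0, k, dk, n0, H, rfl, rfl⟩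
  · rcases H.sw.poR with ⟨h0, k, dk, H0, e⟩ | ⟨h0, k, dk, pr0, H0, e, rfl⟩
    · refine (HH.rt ((HS.rfr (.a false B) H0.sw).post (_root_.cc _ _ ≫ k)
        (ds_comp (ds_cc _ _) dk))).cast ?_ ?_
      · have e' := congrArg (fun x => _root_.cc _ _ ≫ x) e
        rw [cc_cc_assoc] at e'
        rw [e']
        simp only [Category.assoc, Fr.map, cc_nat_assoc, sR]
        have : (_root_.cc A C ≫ h0) ⩕ 𝟙 B = (_root_.cc A C ⩕ 𝟙 B) ≫ (h0 ⩕ 𝟙 B) := by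
          simp [cm_comp]
        rw [this, reassoc_of% (at_hex C A B), cc_cc_assoc, Category.assoc]
      · cases o <;> simp [Fr.off, Form.size, add_assoc]
    · refine ((HH.rt H0.sw).ar A k dk).cast ?_ ?_
      · have e' := congrArg (fun x => _root_.cc _ _ ≫ x) e
        rw [cc_cc_assoc] at e'
        rw [e', sR_a_false']
        simp only [Category.assoc]
        rw [reassoc_of% (at_hex C A B), cm_comp_assoc, cc_cc, Category.id_comp, cm_id,
          Category.id_comp, at_af_assoc, cm_comp_assoc, Category.id_comp]
      · cases o <;> simp [Form.size, add_assoc]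
  · have Hi := H
    clear H
    rcases Hi.and with ⟨pl, pr, o, H, rfl⟩ | ⟨h0, k', dk', H, rfl⟩ | ⟨h0, k', dk', n0, H, rfl, rfl⟩
    · refine (HH.rt ((HS.rfr (.a true C) H).post k dk)).cast ?_ (by simp [Fr.off])
      simp [Fr.map, sR]
    · refine (H.al (B ⋏ C) (_ ≫ (k' ⩕ 𝟙 _) ≫ k)
        (ds_comp (ds_at _ _ _) (ds_comp (ds_cm dk' (ds_id _)) dk))).cast ?_ rfl
      rw [← cm_id, at_nat_assoc, cm_comp_assoc]; simp
    · refine (((H.al C (𝟙 _) (ds_id _)).ar A (_ ≫ (k' ⩕ 𝟙 _) ≫ k)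
        (ds_comp (ds_at _ _ _) (ds_comp (ds_cm dk' (ds_id _)) dk)))).cast ?_ rfl
      rw [Category.comp_id, at_nat_assoc, cm_comp_assoc]; simp
  · refine (((H.ar B (𝟙 _) (ds_id _)).ar A (_ ≫ k)
        (ds_comp (ds_at _ _ _) dk))).cast ?_ (by simp [Form.size, add_assoc])
    rw [Category.comp_id, at_nat_assoc, cm_id]

theorem PullH.dd (A B C : Form P) : PullH p (dd A B C) (fun m => m) := by
  intro Z h n Ho
  rcases Ho.or with ⟨h0, k, dk, H, rfl⟩ | ⟨h0, k, dk, n0, H, rfl, rfl⟩ | ⟨hd, hA, k, dk, rfl, rfl⟩ |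
        ⟨hd, rfl, k, dk, rfl, rfl⟩
  · have Hi := H
    clear H
    rcases Hi.and with ⟨pl, pr, o, H, rfl⟩ | ⟨h0, k', dk', H, rfl⟩ | ⟨h0, k', dk', n0, H, rfl, rfl⟩
    · refine (HH.rt ((HS.rfr (.o true C) H).post k dk)).cast ?_ (by simp [Fr.off])
      simp [Fr.map, sR]
    · refine (H.al (B ⋎ C) (_ ≫ (k' ⩖ 𝟙 _) ≫ k)
        (ds_comp (ds_dd _ _ _) (ds_comp (ds_dm dk' (ds_id _)) dk))).cast ?_ rfl
      rw [← dm_id, dd_nat_assoc, dm_comp_assoc]; simp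
    · refine (((H.ol C (𝟙 _) (ds_id _)).ar A (_ ≫ (k' ⩖ 𝟙 _) ≫ k)
        (ds_comp (ds_dd _ _ _) (ds_comp (ds_dm dk' (ds_id _)) dk)))).cast ?_ rfl
      rw [Category.comp_id, dd_nat_assoc, dm_comp_assoc]; simp
  · refine (((H.or' B (𝟙 _) (ds_id _)).ar A (_ ≫ k)
        (ds_comp (ds_dd _ _ _) dk))).cast ?_ (by simp [Form.size, add_assoc])
    rw [Category.comp_id, dd_nat_assoc, cm_id]
  · cases hA
    refine (HH.rt ((HS.bR true C hd).post k dk)).cast ?_ ?_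
    · simp [sR, eO]
    · simp [Fr.off, hd.sizeL]
  · refine ((HH.br B hd (𝟙 _) (ds_id _)).ar A k dk).cast ?_ (by simp [Form.size, add_assoc])
    rw [Category.comp_id, ← hd.dd]; simp

theorem PullH.bt (A B C : Form P) : PullH p (bt A B C) (fun m => m) := by
  intro Z h n Ho
  rcases Ho.or with ⟨h0, k, dk, H, rfl⟩ | ⟨h0, k, dk, n0, H, rfl, rfl⟩ | ⟨hd, hA, k, dk, rfl, rfl⟩ |
        ⟨hd, rfl, k, dk, rfl, rfl⟩
  · have Hi := H
    clear H
    rcases Hi.or with ⟨h0, k', dk', H, rfl⟩ | ⟨h0, k', dk', n0, H, rfl, rfl⟩ |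
        ⟨hd, rfl, k', dk', rfl, rfl⟩ | ⟨hd, rfl, k', dk', rfl, rfl⟩
    · refine (H.ol (B ⋎ C) (_ ≫ (k' ⩖ 𝟙 _) ≫ k)
        (ds_comp (ds_bt _ _ _) (ds_comp (ds_dm dk' (ds_id _)) dk))).cast ?_ rfl
      rw [← dm_id, bt_nat_assoc, dm_comp_assoc]; simp
    · refine (((H.ol C (𝟙 _) (ds_id _)).or' A (_ ≫ (k' ⩖ 𝟙 _) ≫ k)
        (ds_comp (ds_bt _ _ _) (ds_comp (ds_dm dk' (ds_id _)) dk)))).cast ?_ rfl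
      rw [Category.comp_id, bt_nat_assoc, dm_comp_assoc]; simp
    · refine (HH.bl (B ⋎ C) hd ((k' ⩖ 𝟙 _) ≫ k) (ds_comp (ds_dm dk' (ds_id _)) dk)).cast ?_ rfl
      rw [← dual_e1 hd]; simp [dm_comp_assoc]
    · refine ((HH.bl C hd (𝟙 _) (ds_id _)).or' A ((k' ⩖ 𝟙 _) ≫ k)
        (ds_comp (ds_dm dk' (ds_id _)) dk)).cast ?_ rfl
      rw [Category.comp_id, ← dual_e2 hd]; simp [dm_comp_assoc]
  · refine (((H.or' B (𝟙 _) (ds_id _)).or' A (_ ≫ k)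
        (ds_comp (ds_bt _ _ _) dk))).cast ?_ (by simp [Form.size, add_assoc])
    rw [Category.comp_id, bt_nat_assoc, dm_id]
  · cases hA
  · refine ((HH.br B hd (𝟙 _) (ds_id _)).or' A k dk).cast ?_ (by simp [Form.size, add_assoc])
    rw [Category.comp_id, ← dual_e3 hd]; simp

theorem PullH.af (C X Y : Form P) : PullH p (af C X Y) (fun m => m) := by
  have c : ∀ A B C : Form P, PullH p (𝟙 A ⩕ _root_.cc B C) _ := fun A B C =>
    PullH.conj (Term.id A) (Term.cConj B C) trivial trivial (PullH.id _) (PullH.cc _ _)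
  rw [af_eq]
  refine PullH.congr ((PullH.cc _ _).comp ((c _ _ _).comp
    ((PullH.at' _ _ _).comp ((PullH.cc _ _).comp (c _ _ _))))) ?_
  intro m hm
  simp only [Form.size, bpos] at hm ⊢
  split_ifs <;> omega

theorem PullH.bf (C X Y : Form P) : PullH p (bf C X Y) (fun m => m) := by
  have c : ∀ A B C : Form P, PullH p (𝟙 A ⩖ _root_.gg B C) _ := fun A B C =>
    PullH.disj (Term.id A) (Term.cDisj C B) trivial trivial (PullH.id _) (PullH.gg _ _)
  rw [bf_eq]
  refine PullH.congr ((PullH.gg _ _).comp ((c _ _ _).comp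
    ((PullH.bt _ _ _).comp ((PullH.gg _ _).comp (c _ _ _))))) ?_
  intro m hm
  simp only [Form.size, bpos] at hm ⊢
  split_ifs <;> omega

theorem pullH_term {A D : Form P} (f : Term P A D) (hf : IsDSTerm f) :
    PullH p (qm f) (bpos f) := by
  induction f with
  | delta => exact hf.elim
  | sigma => exact hf.elim
  | id => exact PullH.id _
  | comp g f ihg ihf => exact (ihf hf.2).comp (ihg hf.1)
  | conj f g ihf ihg => exact PullH.conj f g hf.1 hf.2 (ihf hf.1) (ihg hf.2)
  | disj f g ihf ihg => exact PullH.disj f g hf.1 hf.2 (ihf hf.1) (ihg hf.2)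
  | bConjTo => exact PullH.at' _ _ _
  | bConjFrom => exact PullH.af _ _ _
  | bDisjTo => exact PullH.bt _ _ _
  | bDisjFrom => exact PullH.bf _ _ _
  | cConj => exact PullH.cc _ _
  | cDisj => exact PullH.gg _ _
  | d => exact PullH.dd _ _ _

end PullHsec

open CategoryTheory

section Final
variable {P : Type} {p : P}

theorem dl_sL_transport {fr fr' : Fr P} (I : FrIso fr fr') (A : Form P)
    (h : dl p (fr.app A) ≫ sL fr A _ = fr.map (dl p A)) :
    dl p (fr'.app A) ≫ sL fr' A _ = fr'.map (dl p A) := by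
  have h1 := I.siL A (Form.natom p ⋎ Form.pos p)
  have h2 := congrArg (fun x => (I.j A ⩕ 𝟙 _) ≫ x) h1
  simp only [cm_comp_assoc, I.ji, Category.comp_id, cm_id, Category.id_comp] at h2
  rw [h2, reassoc_of% (dl_nat p (I.j A)), reassoc_of% h, I.ni, ← Category.assoc, I.ji,
    Category.id_comp]

theorem dl_sL (fr : Fr P) (A : Form P) :
    dl p (fr.app A) ≫ sL fr A _ = fr.map (dl p A) := by
  have h1 : ∀ C, dl p ((Fr.a false C).app A) ≫ sL (.a false C) A _ = (Fr.a false C).map (dl p A) := by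
    intro C; rw [sL_a_false]; exact dl_af _ _ _
  have h2 : ∀ C, dl p ((Fr.o true C).app A) ≫ sL (.o true C) A _ = (Fr.o true C).map (dl p A) := by
    intro C
    simp only [sL, sR, Fr.map]
    rw [reassoc_of% (dl_cc_dd p A C), dm_comp, Category.assoc, cc_cc, Category.comp_id,
      Category.comp_id]
  rcases fr with ⟨s, C⟩ | ⟨s, C⟩
  · exact dl_sL_transport (frA false s C) A (h1 C)
  · exact dl_sL_transport (frO true s C) A (h2 C)

/-- The unit with crown `p ∨ ¬p`. -/
def dlt (p : P) (A : Form P) : A ⟶ A ⋏ (Form.pos p ⋎ Form.natom p) := dl p A ≫ (𝟙 A ⩕ gg _ _)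

theorem dlt_nat {A D : Form P} (f : A ⟶ D) : dlt p A ≫ (f ⩕ 𝟙 _) = f ≫ dlt p D := by
  rw [dlt, Category.assoc, cm_comp, dlt, ← reassoc_of% (dl_nat p f), cm_comp]
  simp

theorem dlt_sL (fr : Fr P) (A : Form P) :
    dlt p (fr.app A) ≫ sL fr A _ = fr.map (dlt p A) := by
  rw [dlt, Category.assoc, sL_nat1, reassoc_of% (dl_sL (p := p) fr A), map_comp, dlt]

theorem dlt_af (A B : Form P) : dlt p (A ⋏ B) ≫ af A B _ = 𝟙 A ⩕ dlt p B := by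
  have := dlt_sL (p := p) (.a false A) B
  rwa [sL_a_false] at this

theorem dlt_dd {e} (hd : Dual p (.natom p) (.pos p) e true) :
    dlt p (.natom p) ≫ dd _ _ _ ≫ e (.natom p) = 𝟙 _ := by
  cases hd
  have := dl_dd_sg' p
  simpa [dlt] using this

theorem G_base {e} (hd : Dual p (.natom p) (.pos p) e true) (D : Form P) :
    dlt p (D ⋎ Form.natom p) ≫ dd _ (.pos p) (.natom p) ≫
      ((sL (.o false D) (.natom p) (.pos p) ≫ gg _ _ ≫ e D) ⩖ 𝟙 (Form.natom p)) = 𝟙 _ := by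
  have hs : dd (D ⋎ .natom p) (.pos p) (.natom p) ≫ (sL (.o false D) (.natom p) (.pos p) ⩖ 𝟙 (Form.natom p)) =
      sL (.o false D) (.natom p) (.pos p ⋎ .natom p) ≫
        (𝟙 D ⩖ dd (.natom p) (.pos p) (.natom p)) ≫ bt D _ _ := by
    simp only [sL_o_false]
    have h := congrArg (fun x => x ≫ bt _ _ _) (dd_bdisj D (.natom p) (.pos p) (.natom p))
    simp only [Category.assoc, bf_bt, Category.comp_id] at h
    exact h.symm
  have h3 := dlt_sL (p := p) (.o false D) (.natom p)
  have e1 : ((sL (.o false D) (.natom p) (.pos p) ≫ gg _ _ ≫ e D) ⩖ 𝟙 (Form.natom p)) =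
     (sL (.o false D) (.natom p) (.pos p) ⩖ 𝟙 (Form.natom p)) ≫ ((gg _ _ ≫ e D) ⩖ 𝟙 (Form.natom p)) := by
    simp [dm_comp]
  rw [e1, reassoc_of% hs, dual_e2 hd, reassoc_of% h3]
  simp only [Fr.map, dm_comp, Category.comp_id]
  rw [dlt_dd hd, dm_id]

theorem G1 {E Z : Form P} {h : E ⋏ .pos p ⟶ Z} {pl pr : ℕ} (H : HS p h pl pr true) :
    DS (dlt p E ≫ dd E _ _ ≫ (h ⩖ 𝟙 (Form.natom p))) := by
  have key : ∀ {E B Z : Form P} {h : E ⋏ B ⟶ Z} {pl pr : ℕ} {o : Bool}, HS p h pl pr o →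
      ∀ (_ : o = true) (hB : B = .pos p),
      DS (dlt p E ≫ dd E _ _ ≫ ((hB ▸ h : E ⋏ .pos p ⟶ Z) ⩖ 𝟙 (Form.natom p))) := by
    intro E B Z h pl pr o H
    induction H with
    | post k dk _ ih =>
      intro ho hB; subst hB
      have := ds_comp (ih ho rfl) (ds_dm dk (ds_id (.natom p)))
      simpa [dm_comp] using this
    | @lfr fr A B Z h pl pr o H ih =>
      intro ho hB; subst hB
      obtain ⟨k', dk', e⟩ := push_all fr (.o true (.natom p)) (.inr rfl) h (𝟙 _) (ds_id _)
      simp only [Category.comp_id] at e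
      have e2 : dd (fr.app A) (.pos p) (.natom p) ≫
        ((sL fr A (.pos p) ≫ fr.map h) ⩖ 𝟙 (Form.natom p)) = _ := e
      dsimp only
      rw [e2, reassoc_of% (dlt_sL (p := p) fr A), map_comp_assoc]
      exact ds_comp (ds_map fr (ih ho rfl)) dk'
    | rfr fr H ih => intro ho hB; rcases fr with ⟨_ | _, C⟩ | ⟨_ | _, C⟩ <;> cases hB
    | @bL a b e o s D hd =>
      intro ho hB; subst ho hB
      have hd' := hd
      cases hd
      have hb := G_base hd' D
      cases s
      · dsimp only [eO]
        rw [hb]; exact ds_id _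
      · have h2 : sL (.o true D) (.natom p) (.pos p) ≫ eO (fun D => (cc _ _ ⩖ 𝟙 D) ≫ sg p D) true D =
          (gg _ _ ⩕ 𝟙 _) ≫ sL (.o false D) (.natom p) (.pos p) ≫ gg _ _ ≫ (cc _ _ ⩖ 𝟙 D) ≫ sg p D := by
          have h5 : (gg _ _ ⩕ 𝟙 _) ≫ sL (.o false D) (.natom p) (.pos p) =
              sL (.o true D) (.natom p) (.pos p) ≫ gg _ _ := (FrIso.o D).siL (.natom p) (.pos p)
          rw [reassoc_of% h5, gg_gg_assoc]
          rfl
        dsimp only at hb ⊢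
        rw [h2]
        have h3 : ∀ {X Y Z W : Form P} (x : X ⟶ Y) (y : Y ⟶ Z), (x ≫ y) ⩖ 𝟙 W = (x ⩖ 𝟙 W) ≫ (y ⩖ 𝟙 W) := by
          intros; simp [dm_comp]
        rw [h3, ← dd_nat_assoc, dm_id, reassoc_of% (dlt_nat (p := p) (gg (.natom p) D)), hb,
          Category.comp_id]
        exact ds_gg _ _
    | bR s D hd => intro ho hB; cases s <;> cases hB
  exact key H rfl rfl

theorem F1 {E Z : Form P} {h : E ⋏ (.pos p ⋎ .natom p) ⟶ Z} {pl pr : ℕ} {o : Bool}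
    (H : HS p h pl pr o) (ho : o = true) (hpr : pr = 0) : DS (dlt p E ≫ h) := by
  induction H using HS.recOr' with
  | post k dk _ ih _ => rw [← Category.assoc]; exact ds_comp (ih ho hpr) dk
  | lfr fr _ ih _ =>
    rw [reassoc_of% (dlt_sL (p := p) fr), map_comp]
    exact ds_map fr (ih ho hpr)
  | hd1 H0 _ => subst ho; exact G1 H0
  | hd2 H0 _ => simp [Form.size] at hpr
  | b1 hd _ =>
    subst ho
    have hd' := hd
    cases hd
    rw [dlt_dd hd']; exact ds_id _
  | b2 hd _ => simp [Form.size] at hpr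

/-- Unit insertions with normalised crown; position of the positive literal. -/
inductive XX (p : P) : ∀ {G' G : Form P}, (G' ⟶ G) → ℕ → Prop
  | base (B : Form P) : XX p (dlt p B) B.size
  | fr (fr : Fr P) {G' G : Form P} {x : G' ⟶ G} {n : ℕ} : XX p x n → XX p (fr.map x) (fr.off + n)

theorem XX.cast {G' G : Form P} {x : G' ⟶ G} {n m : ℕ} (X : XX p x n) (e : m = n) : XX p x m := by
  subst e; exact X

theorem XX.lt {G' G : Form P} {x : G' ⟶ G} {n : ℕ} (X : XX p x n) : n < G.size ∧ 3 ≤ G.size := by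
  induction X with
  | base B => have := size_pos B; simp only [Form.size]; omega
  | fr fr _ ih =>
    refine ⟨fr_lt fr _ ih.1, ?_⟩
    rcases fr with ⟨_ | _, C⟩ | ⟨_ | _, C⟩ <;> simp only [Form.size] <;> omega

theorem HH.two {G Z : Form P} {h : G ⟶ Z} {n : ℕ} (H : HH p h n) : 2 ≤ G.size := by
  induction H with
  | post _ _ _ ih => exact ih
  | @rt A B _ _ _ _ _ H => 
    have h1 := size_pos A; have h2 := size_pos B; simp only [Form.size]; omega
  | fr fr _ ih => rcases fr with ⟨_ | _, C⟩ | ⟨_ | _, C⟩ <;> simp only [Form.size] <;> omega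
  | bs s D hd =>
    have h1 := hd.sizeL; have h2 := hd.sizeR
    cases s <;> simp only [Form.size] <;> omega

theorem dlt_sR (A B : Form P) :
    (𝟙 A ⩕ dlt p B) ≫ sR (.a false B) A _ = cc A B ≫ (𝟙 B ⩕ dlt p A) := by
  rw [sR_a_false', ← dlt_af, ← dlt_af, Category.assoc, af_at_assoc, reassoc_of% dlt_nat (p := p) (cc A B)]

theorem F2core (fr : Fr P) {A G' G W Z : Form P} {x : G' ⟶ G} {h0 : A ⋏ G ⟶ W}
    (h : DS ((𝟙 A ⩕ x) ≫ h0)) (k : fr.app W ⟶ Z) (dk : DS k) :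
    DS ((𝟙 A ⩕ fr.map x) ≫ sR fr A G ≫ fr.map h0 ≫ k) := by
  rw [sR_nat_assoc, map_comp_assoc]
  exact ds_comp (ds_sR _ _ _) (ds_comp (ds_map fr h) dk)

theorem F2core' (fr : Fr P) {A G' G W : Form P} {x : G' ⟶ G} {h0 : A ⋏ G ⟶ W}
    (h : DS ((𝟙 A ⩕ x) ≫ h0)) :
    DS ((𝟙 A ⩕ fr.map x) ≫ sR fr A G ≫ fr.map h0) := by
  simpa using F2core fr h (𝟙 _) (ds_id _)

theorem F2lfr (fr : Fr P) {A G' G W : Form P} {x : G' ⟶ G} {h0 : A ⋏ G ⟶ W}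
    (h : DS ((𝟙 A ⩕ x) ≫ h0)) :
    DS ((𝟙 (fr.app A) ⩕ x) ≫ sL fr A G ≫ fr.map h0) := by
  rw [sL_nat1_assoc, map_comp]
  exact ds_comp (ds_sL _ _ _) (ds_map fr h)

theorem F2 {G' G : Form P} {x : G' ⟶ G} {n : ℕ} (X : XX p x n) :
    ∀ {A Z : Form P} {h : A ⋏ G ⟶ Z} {pl pr : ℕ} {o : Bool}, HS p h pl pr o → o = true → pr = n →
      DS ((𝟙 A ⩕ x) ≫ h) := by
  induction X with
  | base B =>
    intro A Z h pl pr o H ho hn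
    subst ho hn
    rcases H.poR with ⟨h0, k, dk, H0, rfl⟩ | ⟨h0, k, dk, pr0, H0, rfl, hpr⟩
    · exact absurd H0.lt.2 (lt_irrefl _)
    · rw [reassoc_of% (dlt_sR (p := p) A B), cm_comp_assoc, Category.id_comp]
      exact ds_comp (ds_cc _ _) (ds_comp (ds_cm (ds_id _) (F1 H0 rfl (by omega))) dk)
  | @fr fr G' G x n X ih =>
    intro A Z h pl pr o H ho hn
    have hl := X.lt
    rcases fr with ⟨_ | _, C⟩ | ⟨_ | _, C⟩ <;> simp only [Fr.off] at hn
    · rcases H.poR with ⟨h0, k, dk, H0, rfl⟩ | ⟨h0, k, dk, pr0, H0, rfl, hpr⟩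
      · have := H0.lt.2; omega
      · exact F2core (.a false C) (ih H0 ho (by omega)) k dk
    · rcases H.poR with ⟨h0, k, dk, H0, rfl⟩ | ⟨h0, k, dk, pr0, H0, rfl, hpr⟩
      · exact F2core (.a true C) (ih H0 ho (by omega)) k dk
      · omega
    · induction H using HS.recOr' with
      | post k dk _ ih _ => rw [← Category.assoc]; exact ds_comp (ih ho hn) dk
      | lfr fr _ ih _ => exact F2lfr fr (ih ho hn)
      | hd1 H0 _ => have := H0.lt.2; omega
      | hd2 H0 _ => exact F2core' (.o false C) (ih H0 ho (by omega))
      | b1 hd _ => have := size_pos C; omega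
      | b2 hd _ => have := hd.sizeR; omega
    · induction H using HS.recOr' with
      | post k dk _ ih _ => rw [← Category.assoc]; exact ds_comp (ih ho hn) dk
      | lfr fr _ ih _ => exact F2lfr fr (ih ho hn)
      | hd1 H0 _ => exact F2core' (.o true C) (ih H0 ho (by omega))
      | hd2 H0 _ => omega
      | b1 hd _ => have := hd.sizeR; omega
      | b2 hd _ => omega

theorem FF {G' G : Form P} {x : G' ⟶ G} {n : ℕ} (X : XX p x n) :
    ∀ {Z : Form P} {h : G ⟶ Z} {m : ℕ}, HH p h m → m = n → DS (x ≫ h) := by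
  induction X with
  | base B =>
    intro Z h m Hi hm
    rcases Hi.and with ⟨pl, pr, o, H, hn⟩ | ⟨h0, k, dk, H, rfl⟩ | ⟨h0, k, dk, n0, H, rfl, hn⟩
    · have := H.lt.1
      cases o
      · simp only [Bool.false_eq_true, if_false] at hn; omega
      · simp only [if_true] at hn; exact F1 H rfl (by omega)
    · have := H.lt; omega
    · rcases H.or with ⟨h0, k, dk, H2, e⟩ | ⟨h0, k, dk, n0, H2, e, hn⟩ | ⟨hd, hA, k, dk, e, hn⟩ |
        ⟨hd, hA, k, dk, e, hn⟩
      · have := H2.two; simp [Form.size] at this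
      · have := H2.two; simp [Form.size] at this
      · cases hA
      · cases hA
  | @fr fr G' G x n X ih =>
    intro Z h m Hi hm
    have hl := X.lt
    rcases fr with ⟨_ | _, C⟩ | ⟨_ | _, C⟩ <;> simp only [Fr.off] at hm <;> simp only [Fr.map]
    · rcases Hi.and with ⟨pl, pr, o, H, hn⟩ | ⟨h0, k, dk, H, rfl⟩ | ⟨h0, k, dk, n0, H, rfl, hn⟩
      · have := H.lt.1
        cases o
        · simp only [Bool.false_eq_true, if_false] at hn; omega
        · simp only [if_true] at hn; exact F2 X H rfl (by omega)
      · have := H.lt; omega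
      · rw [cm_comp_assoc, Category.comp_id]
        exact ds_comp (ds_cm (ds_id _) (ih H (by omega))) dk
    · rcases Hi.and with ⟨pl, pr, o, H, hn⟩ | ⟨h0, k, dk, H, rfl⟩ | ⟨h0, k, dk, n0, H, rfl, hn⟩
      · have := H.lt.1
        cases o
        · simp only [Bool.false_eq_true, if_false] at hn
          have h2 := F2 X H.sw rfl (by omega)
          have h3 := ds_comp (ds_cc G' C) h2
          rwa [← cc_nat_assoc, cc_cc_assoc] at h3
        · simp only [if_true] at hn; omega
      · rw [cm_comp_assoc, Category.comp_id]
        exact ds_comp (ds_cm (ih H (by omega)) (ds_id _)) dk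
      · omega
    · rcases Hi.or with ⟨h0, k, dk, H, rfl⟩ | ⟨h0, k, dk, n0, H, rfl, hn⟩ | ⟨hd, hA, k, dk, e, hn⟩ |
        ⟨hd, hA, k, dk, e, hn⟩
      · have := H.lt; omega
      · rw [dm_comp_assoc, Category.comp_id]
        exact ds_comp (ds_dm (ds_id _) (ih H (by omega))) dk
      · have h1 := hd.sizeL; have h2 := hd.sizeR
        have h3 := congrArg Form.size hA
        simp only [Form.size] at h3
        split_ifs at hn <;> omega
      · have h1 := hd.sizeL; have h2 := hd.sizeR
        have h3 := congrArg Form.size hA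
        simp only [Form.size] at h3
        omega
    · rcases Hi.or with ⟨h0, k, dk, H, rfl⟩ | ⟨h0, k, dk, n0, H, rfl, hn⟩ | ⟨hd, hA, k, dk, e, hn⟩ |
        ⟨hd, hA, k, dk, e, hn⟩
      · rw [dm_comp_assoc, Category.comp_id]
        exact ds_comp (ds_dm (ih H (by omega)) (ds_id _)) dk
      · omega
      · have h1 := hd.sizeL; have h2 := hd.sizeR
        have h3 := congrArg Form.size hA
        simp only [Form.size] at h3
        omega
      · omega

/-- Normal form of the unit terms. -/
theorem xi_norm {A B : Form P} {g : Term P A B} {kp kn : ℕ} {cp} (hg : IsXiConjTerm p g kp kn cp) :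
    kp < B.size ∧ ∃ (B0 : Form P) (x : A ⟶ B0) (d : Term P B0 B), IsDSTerm d ∧ qm g = x ≫ qm d ∧
      XX p x (bpos d kp) := by
  have b0 : ∀ B : Form P, qm (Term.delta p B) =
      dlt p B ≫ qm (Term.id B ⊼ Term.cDisj (Form.natom p) (Form.pos p)) := by
    intro B
    rw [dlt, Category.assoc]
    change dl p B = dl p B ≫ (𝟙 B ⩕ gg _ _) ≫ (𝟙 B ⩕ gg _ _)
    rw [cm_comp, gg_gg, Category.comp_id, cm_id, Category.comp_id]
  have b1 : ∀ B : Form P, qm (delta' p B) = dlt p B := fun B => rfl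
  induction hg with
  | delta B =>
    refine ⟨by simp [Form.size], _, _, _, ?_, b0 B, ?_⟩
    · simp [IsDSTerm]
    · have : bpos (Term.id B ⊼ Term.cDisj (Form.natom p) (Form.pos p)) (B.size + 1) = B.size := by
        simp [bpos, Form.size]
      rw [this]; exact .base B
  | delta' B =>
    refine ⟨by simp [Form.size], _, dlt p B, Term.id _, trivial, ?_, ?_⟩
    · rw [b1, qm_id, Category.comp_id]
    · exact .base B
  | sigmaConj B =>
    refine ⟨by simp [Form.size]; omega, _, dlt p B, Term.cConj _ _ ⬝
      (Term.id B ⊼ Term.cDisj (Form.natom p) (Form.pos p)), ?_, ?_, ?_⟩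
    · simp [IsDSTerm]
    · rw [qm_comp, ← Category.assoc, ← b0]; rfl
    · have : bpos (Term.cConj _ _ ⬝ (Term.id B ⊼ Term.cDisj (Form.natom p) (Form.pos p))) 1
          = B.size := by
        simp [bpos, Form.size]
      rw [this]; exact .base B
  | sigmaConj' B =>
    refine ⟨by simp [Form.size], _, dlt p B, Term.cConj _ _, trivial, ?_, ?_⟩
    · rfl
    · have : bpos (Term.cConj B (Form.pos p ⋎ Form.natom p)) 0 = B.size := by
        simp [bpos, Form.size]
      rw [this]; exact .base B
  | conjL A _ ih =>
    obtain ⟨hlt, B0, x, d, hd, e, X⟩ := ih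
    refine ⟨by simp only [Form.size]; omega, _, 𝟙 A ⩕ x, Term.id A ⊼ d, ⟨trivial, hd⟩, ?_, ?_⟩
    · rw [qm_conj, qm_conj, e, qm_id, cm_comp, Category.comp_id]
    · exact (X.fr (.a false A)).cast (by simp [bpos, Fr.off])
  | conjR A _ ih =>
    obtain ⟨hlt, B0, x, d, hd, e, X⟩ := ih
    refine ⟨by simp only [Form.size]; omega, _, x ⩕ 𝟙 A, d ⊼ Term.id A, ⟨hd, trivial⟩, ?_, ?_⟩
    · rw [qm_conj, qm_conj, e, qm_id, cm_comp, Category.comp_id]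
    · exact (X.fr (.a true A)).cast (by simp [bpos, hlt, Fr.off])
  | disjL A _ ih =>
    obtain ⟨hlt, B0, x, d, hd, e, X⟩ := ih
    refine ⟨by simp only [Form.size]; omega, _, 𝟙 A ⩖ x, Term.id A ⊽ d, ⟨trivial, hd⟩, ?_, ?_⟩
    · rw [qm_disj, qm_disj, e, qm_id, dm_comp, Category.comp_id]
    · exact (X.fr (.o false A)).cast (by simp [bpos, Fr.off])
  | disjR A _ ih =>
    obtain ⟨hlt, B0, x, d, hd, e, X⟩ := ih
    refine ⟨by simp only [Form.size]; omega, _, x ⩖ 𝟙 A, d ⊽ Term.id A, ⟨hd, trivial⟩, ?_, ?_⟩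
    · rw [qm_disj, qm_disj, e, qm_id, dm_comp, Category.comp_id]
    · exact (X.fr (.o true A)).cast (by simp [bpos, hlt, Fr.off])

theorem theta_HH {A B : Form P} {g : Term P A B} {kp kn : ℕ} {cp}
    (hg : IsThetaDisjTerm p g kp kn cp) : HH p (qm g) kp := by
  induction hg with
  | sigma B => exact (HH.bs true B .pn).cast rfl rfl
  | sigma' B => exact (HH.bs true B .np).cast rfl rfl
  | deltaDisj B => exact (HH.bs false B .pn).cast rfl rfl
  | deltaDisj' B => exact (HH.bs false B .np).cast rfl rfl
  | conjL A _ ih => exact (HH.fr (.a false A) ih).cast rfl rfl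
  | conjR A _ ih => exact (HH.fr (.a true A) ih).cast rfl (by simp [Fr.off])
  | disjL A _ ih => exact (HH.fr (.o false A) ih).cast rfl rfl
  | disjR A _ ih => exact (HH.fr (.o true A) ih).cast rfl (by simp [Fr.off])

theorem main_aux {A B A' B' : Form P} {a₂ a₃ b₁ b₂ : ℕ}
    (g₁ : Term P A' A) (π : List Dir) (hg₁ : IsXiConjTerm p g₁ a₂ a₃ π)
    (g₂ : Term P B B') (ρ : List Dir) (hg₂ : IsThetaDisjTerm p g₂ b₂ b₁ ρ)
    (f : Term P A B) (hf : IsDSTerm f) (hl₂ : Linked f a₂ b₂) :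
    ∃ k : Term P A' B', IsDSTerm k ∧ Eqv (g₂ ⬝ (f ⬝ g₁)) k := by
  obtain ⟨_, B0, x, d, hd, e, X⟩ := xi_norm hg₁
  have H := pullH_term d hd (pullH_term f hf (theta_HH hg₂))
  have hk : DS (x ≫ _) := FF X H (by rw [linked_bpos hf hl₂])
  obtain ⟨k, hk, ek⟩ := hk
  refine ⟨k, hk, eqv_of_qm ?_⟩
  rw [ek, qm_comp, qm_comp, e, Category.assoc, Category.assoc]

end Final


/-- **¬p-p-¬p Lemma**: let `¬x₁, x₂, ¬x₃` be occurrences of `¬p, p, ¬p`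
respectively in a formula `A` of L∧,∨^{¬p}, and `¬y₁, y₂, ¬y₃` occurrences of
`¬p, p, ¬p` respectively in a formula `B` of L∧,∨^{¬p}.  Let `g₁ : A′ ⊢ A` be a
`Ξ̂∧_{p,C}`-term of PN whose head's crown is `x₂ ∨ ¬x₃` or `¬x₃ ∨ x₂`, let
`g₂ : B ⊢ B′` be a `Θ̂∨_{p,D}`-term of PN whose head's crown is `¬y₁ ∧ y₂` or
`y₂ ∧ ¬y₁`, and let `f : A ⊢ B` be an arrow term of DS^{¬p} such that `x_i` and
`y_i` are linked in `f` for `i ∈ {1,2,3}`.  Then `g₂ ∘ f ∘ g₁` is equal in PN to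
an arrow term of DS^{¬p}. -/
theorem negp_p_negp_lemma {P : Type} (p : P) {A B A' B' : Form P}
    (a₁ a₂ a₃ b₁ b₂ b₃ : ℕ)
    (hA₁ : A.letterAt a₁ = some (Form.natom p)) (hA₂ : A.letterAt a₂ = some (Form.pos p))
    (hA₃ : A.letterAt a₃ = some (Form.natom p))
    (hB₁ : B.letterAt b₁ = some (Form.natom p)) (hB₂ : B.letterAt b₂ = some (Form.pos p))
    (hB₃ : B.letterAt b₃ = some (Form.natom p))
    (g₁ : Term P A' A) (π : List Dir) (hg₁ : IsXiConjTerm p g₁ a₂ a₃ π)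
    (g₂ : Term P B B') (ρ : List Dir) (hg₂ : IsThetaDisjTerm p g₂ b₂ b₁ ρ)
    (f : Term P A B) (hf : IsDSTerm f)
    (hl₁ : Linked f a₁ b₁) (hl₂ : Linked f a₂ b₂) (hl₃ : Linked f a₃ b₃) :
    ∃ k : Term P A' B', IsDSTerm k ∧ Eqv (g₂ ⬝ (f ⬝ g₁)) k := by
  exact main_aux g₁ π hg₁ g₂ ρ hg₂ f hf hl₂
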